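/- arXiv:math/9808018 — 2 statements merged into one kernel-verified Lean document; each statement's English description precedes it below -/
import Mathlib

section
/- Let x and y be positive integers. The number of plane partitions S contained in the 2x×2x×(2y+1) box that are self-complementary, i.e., (i,j,k) ∈ S if and only if (2x-1-i, 2x-1-j, 2y-k) ∉ S, equals PP(x,x,y) · PP(x,x,y+1). -/
open Finset

/-- MacMahon's box formula `PP(a,b,c) = ∏_{i=1}^{a} ∏_{j=1}^{b} ∏_{k=1}^{c} (i+j+k-1)/(i+j+k-2)`. -/
def PP (a b c : ℕ) : ℚ :=
  ∏ i ∈ Finset.Icc 1 a, ∏ j ∈ Finset.Icc 1 b, ∏ k ∈ Finset.Icc 1 c,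
    (((i : ℚ) + j + k - 1) / ((i : ℚ) + j + k - 2))

open scoped Nat

/-- The Vandermonde product `∏_{i<j<n} (l j - l i)`. -/
def vandermondeProd (n : ℕ) (l : ℕ → ℚ) : ℚ := ∏ j ∈ range n, ∏ i ∈ range j, (l j - l i)

theorem vandermondeProd_succ (n : ℕ) (l : ℕ → ℚ) :
    vandermondeProd (n + 1) l = vandermondeProd n l * ∏ i ∈ range n, (l n - l i) :=
  prod_range_succ _ _

theorem vandermondeProd_succ' (n : ℕ) (l : ℕ → ℚ) :
    vandermondeProd (n + 1) l =
      (∏ i ∈ range n, (l (i + 1) - l 0)) * vandermondeProd n fun i => l (i + 1) := by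
  unfold vandermondeProd
  rw [prod_range_succ']
  simp only [prod_range_succ', prod_mul_distrib, range_zero, prod_empty, mul_one]
  rw [mul_comm]

theorem det_vandermonde_eq_vandermondeProd (n : ℕ) (l : ℕ → ℚ) :
    (Matrix.vandermonde fun i : Fin n => l i).det = vandermondeProd n l := by
  rw [Matrix.det_vandermonde]
  induction n generalizing l with
  | zero => simp [vandermondeProd]
  | succ n ih =>
    rw [vandermondeProd_succ', ← ih, Fin.prod_univ_succ, Fin.prod_Ioi_zero]
    simp [Fin.prod_Ioi_succ, prod_range]

theorem vandermondeProd_congr {n : ℕ} {l l' : ℕ → ℚ} (h : ∀ i < n, l i = l' i) :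
    vandermondeProd n l = vandermondeProd n l' :=
  prod_congr rfl fun j hj => prod_congr rfl fun i hi => by
    rw [mem_range] at hj hi
    rw [h j hj, h i (hi.trans hj)]

/-- The sequence of length `2 * x`, symmetric about `N`, whose upper half is `N + m 0, N + m 1, …`. -/
def centered {R : Type*} [Add R] [Sub R] (N : R) (x : ℕ) (m : ℕ → R) (i : ℕ) : R :=
  if i < x then N - m (x - 1 - i) else N + m (i - x)

theorem centered_succ_succ (N : ℚ) (x : ℕ) (m : ℕ → ℚ) (i : ℕ) :
    centered N (x + 1) m (i + 1) = centered N x m i := by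
  simp [centered, show x - (i + 1) = x - 1 - i by omega]

theorem prod_centered (N : ℚ) (x : ℕ) (m : ℕ → ℚ) (g : ℚ → ℚ) :
    ∏ i ∈ range (2 * x), g (centered N x m i) =
      ∏ i ∈ range x, (g (N - m i) * g (N + m i)) := by
  rw [two_mul, prod_range_add, prod_mul_distrib, ← prod_range_reflect (fun i => g (N - m i)) x]
  congr 1
  · exact prod_congr rfl fun i hi => by simp [centered, mem_range.1 hi]
  · exact prod_congr rfl fun i hi => by simp [centered]

theorem vandermondeProd_centered (N : ℚ) (x : ℕ) (m : ℕ → ℚ) :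
    vandermondeProd (2 * x) (centered N x m) =
      (∏ i ∈ range x, 2 * m i) * vandermondeProd x (fun i => m i ^ 2) ^ 2 := by
  induction x with
  | zero => simp [vandermondeProd]
  | succ x ih =>
    have h0 : centered N (x + 1) m 0 = N - m x := by simp [centered]
    rw [show 2 * (x + 1) = 2 * x + 1 + 1 by ring, vandermondeProd_succ', vandermondeProd_succ,
      prod_range_succ]
    simp only [centered_succ_succ]
    have h1 : centered N x m (2 * x) = N + m x := by
      simp [centered, show 2 * x - x = x by omega, show ¬ 2 * x < x by omega]
    rw [ih, h0, h1, prod_centered N x m fun z => z - (N - m x),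
      prod_centered N x m fun z => N + m x - z, prod_range_succ, vandermondeProd_succ]
    have : (∏ i ∈ range x, (N - m i - (N - m x)) * (N + m i - (N - m x))) *
        (∏ i ∈ range x, (N + m x - (N - m i)) * (N + m x - (N + m i))) =
        (∏ i ∈ range x, (m x ^ 2 - m i ^ 2)) ^ 2 := by
      rw [← prod_mul_distrib, ← prod_pow]
      exact prod_congr rfl fun i _ => by ring
    rw [mul_pow, ← this]
    ring

theorem PP_eq_prod_factorial (x y : ℕ) :
    PP x x y = ∏ k ∈ range x,
      ((k ! : ℚ) * (x + y + k)! / ((x + k)! * (x + y - 1 - k)!)) := by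
  have inner : ∀ s : ℕ, ∏ k ∈ Icc 1 y, (((s : ℚ) + 2 + k - 1) / ((s : ℚ) + 2 + k - 2)) =
      ((s : ℚ) + y + 1) / (s + 1) := by
    intro s
    induction y with
    | zero => have : (s : ℚ) + 1 ≠ 0 := by positivity
              simp [this]
    | succ y ih =>
      rw [prod_Icc_succ_top (by omega), ih]
      have h1 : (s : ℚ) + 1 ≠ 0 := by positivity
      have h2 : (s : ℚ) + y + 1 ≠ 0 := by positivity
      have h3 : (s : ℚ) + 2 + (y + 1 : ℕ) - 2 = s + y + 1 := by push_cast; ring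
      rw [h3]
      push_cast
      field_simp
      ring
  have middle : ∀ i b : ℕ, ∏ j ∈ range b, (((i : ℚ) + j + y + 1) / ((i : ℚ) + j + 1)) =
      (i ! : ℚ) * (b + y + i)! / ((b + i)! * (i + y)!) := by
    intro i b
    induction b with
    | zero =>
      simp only [range_zero, prod_empty, zero_add, add_comm y i]
      rw [div_self (by positivity)]
    | succ b ih =>
      rw [prod_range_succ, ih, show b + 1 + y + i = (b + y + i) + 1 by ring,
        show b + 1 + i = (b + i) + 1 by ring, Nat.factorial_succ, Nat.factorial_succ]
      push_cast
      field_simp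
      ring
  have h : PP x x y = ∏ i ∈ range x, ((i ! : ℚ) * (x + y + i)! / ((x + i)! * (i + y)!)) := by
    unfold PP
    simp only [← Ico_add_one_right_eq_Icc, prod_Ico_eq_prod_range, Nat.add_sub_cancel]
    refine prod_congr rfl fun i _ => ?_
    rw [← middle]
    refine prod_congr rfl fun j _ => ?_
    have := inner (i + j)
    simp only [← Ico_add_one_right_eq_Icc, prod_Ico_eq_prod_range, Nat.add_sub_cancel] at this
    push_cast at this ⊢
    rw [← this]
    exact prod_congr rfl fun k _ => by ring
  rw [h]
  simp only [prod_div_distrib, prod_mul_distrib]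
  rw [← prod_range_reflect (fun i => ((i + y)! : ℚ)) x]
  congr 2
  exact prod_congr rfl fun k hk => by
    rw [mem_range] at hk
    rw [show x - 1 - k + y = x + y - 1 - k by omega]

/-- The Cauchy–Binet formula. -/
theorem det_sum_mul_eq_sum_strictMono {R : Type*} [CommRing R] {n : ℕ} (I : Finset ℕ)
    (f g : ℕ → Fin n → R) :
    (Matrix.of fun i j => ∑ a ∈ I, f a i * g a j).det =
      ∑ m ∈ Fintype.piFinset (fun _ : Fin n => I) with StrictMono m,
        (Matrix.of fun i j => f (m i) j).det * (Matrix.of fun i j => g (m i) j).det := by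
  classical
  have expand : (Matrix.of fun i j => ∑ a ∈ I, f a i * g a j).det =
      ∑ m ∈ Fintype.piFinset (fun _ : Fin n => I),
        (∏ i, f (m i) i) * (Matrix.of fun i j => g (m i) j).det := by
    have h := (Matrix.detRowAlternating (R := R) (n := Fin n)).toMultilinearMap.map_sum_finset
      (fun i a => f a i • g a) (fun _ => I)
    simp only [AlternatingMap.coe_multilinearMap] at h
    have h2 : (fun i => ∑ a ∈ I, f a i • g a) =
        Matrix.of fun i j => ∑ a ∈ I, f a i * g a j := by
      ext i j; simp
    rw [h2] at h
    refine h.trans (sum_congr rfl fun m _ => ?_)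
    exact MultilinearMap.map_smul_univ
      (Matrix.detRowAlternating (R := R) (n := Fin n)).toMultilinearMap _ _
  rw [expand, ← sum_filter_of_ne (p := fun m => Function.Injective m)]
  swap
  · intro m _ hm i j hij
    by_contra hne
    exact hm (by rw [Matrix.det_zero_of_row_eq hne (by ext k; simp [hij]), mul_zero])
  have perm_sum : ∀ m : Fin n → ℕ,
      (Matrix.of fun i j => f (m i) j).det * (Matrix.of fun i j => g (m i) j).det =
        ∑ σ : Equiv.Perm (Fin n), (∏ i, f ((m ∘ σ) i) i) *
          (Matrix.of fun i j => g ((m ∘ σ) i) j).det := by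
    intro m
    rw [Matrix.det_apply', sum_mul]
    refine sum_congr rfl fun σ _ => ?_
    have := Matrix.det_permute σ (Matrix.of fun i j => g (m i) j)
    rw [show (Matrix.of fun i j => g ((m ∘ σ) i) j) =
      (Matrix.of fun i j => g (m i) j).submatrix σ id from rfl, this]
    simp only [Matrix.of_apply, Function.comp]
    ring
  rw [sum_congr rfl fun m _ => perm_sum m, ← sum_product']
  symm
  refine sum_bij (fun p _ => p.1 ∘ p.2) ?_ ?_ ?_ ?_
  · rintro ⟨m, σ⟩ h
    simp only [mem_product, mem_filter, Fintype.mem_piFinset, mem_univ, and_true] at h ⊢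
    exact ⟨fun i => h.1 _, h.2.injective.comp σ.injective⟩
  · rintro ⟨m, σ⟩ h ⟨m', σ'⟩ h' heq
    simp only [mem_product, mem_filter, Fintype.mem_piFinset, mem_univ, and_true] at h h'
    simp only at heq
    have hm : m = m' := by
      refine (StrictMono.range_inj h.2 h'.2).1 ?_
      rw [← σ.surjective.range_comp m, heq, σ'.surjective.range_comp]
    subst hm
    have hσ : σ = σ' := by
      ext i
      exact congrArg Fin.val (h.2.injective (congrFun heq i))
    rw [hσ]
  · intro m hm
    simp only [mem_filter, Fintype.mem_piFinset] at hm
    refine ⟨(m ∘ Tuple.sort m, (Tuple.sort m)⁻¹), ?_, ?_⟩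
    · simp only [mem_product, mem_filter, Fintype.mem_piFinset, mem_univ, and_true]
      exact ⟨fun i => hm.1 _, (Tuple.monotone_sort m).strictMono_of_injective
        (hm.2.comp (Tuple.sort m).injective)⟩
    · ext i; simp
  · intros; rfl

theorem det_factorial_div_factorial (n A B : ℕ) :
    (Matrix.of fun i j : Fin n => ((B + i + j)! : ℚ) / (A + i + j)!).det =
      ∏ k ∈ range n, ((k ! : ℚ) * (∏ t ∈ range k, ((A : ℚ) - B + t)) * (B + k)! /
        (A + n - 1 + k)!) := by
  induction n generalizing A B with
  | zero => simp
  | succ n ih =>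
    set M : Matrix (Fin (n + 1)) (Fin (n + 1)) ℚ :=
      Matrix.of fun i j => ((B + i + j)! : ℚ) / (A + i + j)! with hM
    let K : Matrix (Fin (n + 1)) (Fin (n + 1)) ℚ := Matrix.of fun i j =>
      Fin.cases (M i 0) (fun j => M i j.succ -
        ((B + j + 1 : ℚ) / (A + j + 1)) * M i j.castSucc) j
    have hK : M.det = K.det := by
      refine Matrix.det_eq_of_forall_col_eq_smul_add_pred
        (fun j : Fin n => ((B + j + 1 : ℚ) / (A + j + 1))) ?_ ?_
      · intro i; simp [K]
      · intro i j; simp [K]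
    have entry : ∀ i j : Fin n, K i.succ j.succ =
        ((i : ℚ) + 1) * (((A : ℚ) - B) / (A + j + 1) *
          (((B + 1 + i + j)! : ℚ) / (A + 2 + i + j)!)) := by
      intro i j
      simp only [K, hM, Matrix.of_apply, Fin.cases_succ, Fin.val_succ, Fin.val_castSucc]
      rw [show B + (i + 1) + (j + 1) = (B + 1 + i + j) + 1 by ring,
        show A + (i + 1) + (j + 1) = A + 2 + i + j by ring,
        show B + ((i : ℕ) + 1) + j = B + 1 + i + j by ring,
        show A + 2 + (i : ℕ) + j = (A + (i + 1) + j) + 1 by ring,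
        Nat.factorial_succ, Nat.factorial_succ]
      push_cast
      have : (A : ℚ) + j + 1 ≠ 0 := by positivity
      have : (A : ℚ) + (i + 1) + j + 1 ≠ 0 := by positivity
      field_simp
      ring
    have first_row : ∀ j : Fin n, K 0 j.succ = 0 := by
      intro j
      simp only [K, hM, Matrix.of_apply, Fin.cases_succ, Fin.val_succ, Fin.val_castSucc,
        Fin.val_zero, add_zero]
      rw [← add_assoc, ← add_assoc, Nat.factorial_succ, Nat.factorial_succ]
      push_cast
      have : (A : ℚ) + j + 1 ≠ 0 := by positivity
      field_simp
      ring
    rw [hK, Matrix.det_succ_row_zero, Fin.sum_univ_succ]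
    simp only [first_row, mul_zero, zero_mul, sum_const_zero, add_zero]
    have hsub : K.submatrix Fin.succ (Fin.succAbove 0) =
        Matrix.of fun i j : Fin n => ((i : ℚ) + 1) * (Matrix.of (fun i j : Fin n =>
          ((A : ℚ) - B) / (A + j + 1) * (((B + 1 + i + j)! : ℚ) / (A + 2 + i + j)!))) i j := by
      ext i j
      simp [entry]
    rw [hsub, Matrix.det_mul_column]
    have hrow := Matrix.det_mul_row (fun j : Fin n => ((A : ℚ) - B) / (A + j + 1))
      (Matrix.of fun i j : Fin n => (((B + 1 + i + j)! : ℚ) / (A + 2 + i + j)!))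
    simp only [Matrix.of_apply] at hrow ⊢
    rw [hrow, ih (A + 2) (B + 1)]
    have h00 : K 0 0 = (B ! : ℚ) / A ! := by simp [K, hM]
    rw [h00, Fin.prod_univ_eq_prod_range (fun i => (i : ℚ) + 1) n,
      Fin.prod_univ_eq_prod_range (fun j => ((A : ℚ) - B) / (A + j + 1)) n]
    have f1 : ∀ m : ℕ, ∏ k ∈ range m, ((A : ℚ) + k + 1) = (A + m)! / A ! := by
      intro m
      induction m with
      | zero => simp; rw [div_self (by positivity)]
      | succ m ihm =>
        rw [prod_range_succ, ihm, ← add_assoc, Nat.factorial_succ]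
        push_cast
        ring
    rw [prod_range_succ']
    have f2 : ∀ k ∈ range n, (((k + 1)! : ℚ) * (∏ t ∈ range (k + 1), ((A : ℚ) - B + t)) *
        (B + (k + 1))! / (A + (n + 1) - 1 + (k + 1))!) =
        (((k : ℚ) + 1) * ((A : ℚ) - B)) * ((k ! : ℚ) *
          (∏ t ∈ range k, (((A + 2 : ℕ) : ℚ) - (B + 1 : ℕ) + t)) * (B + 1 + k)! /
            (A + 2 + n - 1 + k)!) := by
      intro k _
      rw [prod_range_succ', Nat.factorial_succ, show B + (k + 1) = B + 1 + k by ring,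
        show A + (n + 1) - 1 + (k + 1) = A + 2 + n - 1 + k by omega]
      have : ∀ t ∈ range k, ((A : ℚ) - B + (t + 1 : ℕ)) =
          ((A + 2 : ℕ) : ℚ) - (B + 1 : ℕ) + t := by
        intro t _; push_cast; ring
      rw [prod_congr rfl this]
      push_cast
      ring
    rw [prod_congr rfl f2, prod_mul_distrib, prod_mul_distrib, prod_div_distrib, f1]
    simp
    field_simp

theorem sum_two_mul_prod_sq_sub_sq (N i : ℕ) :
    ∑ m ∈ Icc 1 N, 2 * (m : ℚ) * ∏ k ∈ range i, ((m : ℚ) ^ 2 - (k + 1) ^ 2) =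
      (∏ k ∈ range (i + 1), (((N : ℚ) - k) * (N + 1 + k))) / (i + 1) := by
  have upper : ∀ M : ℚ, ∏ k ∈ range (i + 1), ((M - k) * (M + 1 + k)) =
      M * (M + i + 1) * ∏ k ∈ range i, (M ^ 2 - (k + 1) ^ 2) := by
    intro M
    induction i with
    | zero => simp
    | succ i ih => rw [prod_range_succ, ih, prod_range_succ]; push_cast; ring
  have lower : ∀ M : ℚ, ∏ k ∈ range (i + 1), ((M - 1 - k) * (M + k)) =
      M * (M - i - 1) * ∏ k ∈ range i, (M ^ 2 - (k + 1) ^ 2) := by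
    clear upper
    intro M
    induction i with
    | zero => simp; ring
    | succ i ih => rw [prod_range_succ, ih, prod_range_succ]; push_cast; ring
  induction N with
  | zero => simp [prod_range_succ']
  | succ N ih =>
    have h := lower (N + 1)
    simp only [add_sub_cancel_right] at h
    rw [sum_Icc_succ_top (by omega), ih, h]
    push_cast
    rw [upper]
    field_simp
    ring

/-- The moments `∑ 2m ∏_{k=1}^{i} (m² - k²) ∏_{k=1}^{j} (m² - (N+k)²)`, summed over `1 ≤ m ≤ N`. -/
theorem sum_shifted_moment (N i j : ℕ) :
    ∑ m ∈ Icc 1 N, (2 * (m : ℚ) * ∏ k ∈ range i, ((m : ℚ) ^ 2 - (k + 1) ^ 2)) *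
        ∏ k ∈ range j, ((m : ℚ) ^ 2 - (N + k + 1) ^ 2) =
      (i ! : ℚ) * N.descFactorial (i + 1) * ((-1) ^ j * j ! * (N + j)!) / (N ! * N !) *
        ((N + 1 + i + j)! / (1 + i + j)!) := by
  have desc : ∀ i : ℕ, (N.descFactorial (i + 2) : ℚ) = (N - (i + 1)) * N.descFactorial (i + 1) := by
    intro i
    rw [Nat.descFactorial_succ N (i + 1)]
    rcases le_or_gt (i + 1) N with h | h
    · push_cast [Nat.cast_sub h]; ring
    · rw [Nat.descFactorial_of_lt h]; simp
  induction j generalizing i with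
  | zero =>
    have hdesc : ∀ i : ℕ, (N.descFactorial i : ℚ) = ∏ k ∈ range i, ((N : ℚ) - k) := by
      intro i
      induction i with
      | zero => simp
      | succ i ih =>
        rw [prod_range_succ, ← ih]
        cases i with
        | zero => simp
        | succ i => rw [desc]; push_cast; ring
    have hfact : ((N + 1 + i)! : ℚ) = N ! * ∏ k ∈ range (i + 1), ((N : ℚ) + 1 + k) := by
      induction i with
      | zero => rw [add_zero, Nat.factorial_succ]; push_cast; simp; ring
      | succ i ih =>
        rw [prod_range_succ, ← mul_assoc, ← ih, ← add_assoc, Nat.factorial_succ]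
        push_cast; ring
    simp only [range_zero, prod_empty, mul_one, add_zero, pow_zero, Nat.factorial_zero,
      Nat.cast_one]
    rw [sum_two_mul_prod_sq_sub_sq, hdesc, hfact, prod_mul_distrib, add_comm 1 i,
      Nat.factorial_succ]
    push_cast
    field_simp
  | succ j ih =>
    have hrec : ∀ m : ℕ, (2 * (m : ℚ) * ∏ k ∈ range i, ((m : ℚ) ^ 2 - (k + 1) ^ 2)) *
        ∏ k ∈ range (j + 1), ((m : ℚ) ^ 2 - (N + k + 1) ^ 2) =
        (2 * (m : ℚ) * ∏ k ∈ range (i + 1), ((m : ℚ) ^ 2 - (k + 1) ^ 2)) *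
          ∏ k ∈ range j, ((m : ℚ) ^ 2 - (N + k + 1) ^ 2) +
        (((i : ℚ) + 1) ^ 2 - (N + j + 1) ^ 2) *
          ((2 * (m : ℚ) * ∏ k ∈ range i, ((m : ℚ) ^ 2 - (k + 1) ^ 2)) *
            ∏ k ∈ range j, ((m : ℚ) ^ 2 - (N + k + 1) ^ 2)) := by
      intro m
      rw [prod_range_succ, prod_range_succ]
      ring
    rw [sum_congr rfl fun m _ => hrec m, sum_add_distrib, ← mul_sum, ih, ih, desc,
      show N + 1 + (i + 1) + j = (N + 1 + i + j) + 1 by ring,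
      show N + 1 + i + (j + 1) = (N + 1 + i + j) + 1 by ring,
      show 1 + (i + 1) + j = (1 + i + j) + 1 by ring,
      show 1 + i + (j + 1) = (1 + i + j) + 1 by ring, ← add_assoc N j 1]
    simp only [Nat.factorial_succ]
    push_cast
    field_simp
    ring

theorem det_prod_sub_eq_det_vandermonde {R : Type*} [CommRing R] [Nontrivial R] [NoZeroDivisors R]
    {n : ℕ} (v : Fin n → R) (c : ℕ → R) :
    (Matrix.of fun i j : Fin n => ∏ k ∈ range j, (v i - c k)).det =
      (Matrix.vandermonde v).det := by
  rw [Matrix.det_eval_matrixOfPolynomials_eq_det_vandermonde v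
    (fun j => ∏ k ∈ range j, (Polynomial.X - Polynomial.C (c k)))]
  · simp [Polynomial.eval_prod]
  · intro j
    simp [Polynomial.natDegree_prod_of_monic _ _ fun k _ => Polynomial.monic_X_sub_C (c k)]
  · intro j
    exact Polynomial.monic_prod_of_monic _ _ fun k _ => Polynomial.monic_X_sub_C (c k)

theorem sum_strictMono_vandermonde_sq (N x : ℕ) (hN : x ≤ N) :
    ∑ m ∈ Fintype.piFinset (fun _ : Fin x => Icc 1 N) with StrictMono m,
        (∏ i, 2 * (m i : ℚ)) * (Matrix.vandermonde fun i => (m i : ℚ) ^ 2).det ^ 2 =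
      ∏ k ∈ range x, ((k ! : ℚ) ^ 3 * (N + k)! * (N + 1 + k)! /
        ((N - 1 - k)! * (N - k)! * (x + k)!)) := by
  have h := det_sum_mul_eq_sum_strictMono (n := x) (Icc 1 N)
    (fun a i => 2 * (a : ℚ) * ∏ k ∈ range i, ((a : ℚ) ^ 2 - (k + 1) ^ 2))
    (fun a j => ∏ k ∈ range j, ((a : ℚ) ^ 2 - (N + k + 1) ^ 2))
  simp only [sum_shifted_moment] at h
  have hterm : ∀ m : Fin x → ℕ,
      (∏ i, 2 * (m i : ℚ)) * (Matrix.vandermonde fun i => (m i : ℚ) ^ 2).det ^ 2 =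
      (Matrix.of fun i j : Fin x =>
        2 * (m i : ℚ) * ∏ k ∈ range j, ((m i : ℚ) ^ 2 - (k + 1) ^ 2)).det *
      (Matrix.of fun i j : Fin x => ∏ k ∈ range j, ((m i : ℚ) ^ 2 - (N + k + 1) ^ 2)).det := by
    intro m
    have h1 := Matrix.det_mul_column (fun i => 2 * (m i : ℚ))
      (Matrix.of fun i j : Fin x => ∏ k ∈ range j, ((m i : ℚ) ^ 2 - (k + 1) ^ 2))
    simp only [Matrix.of_apply] at h1
    rw [h1, det_prod_sub_eq_det_vandermonde (fun i => (m i : ℚ) ^ 2) (fun k => ((k : ℚ) + 1) ^ 2),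
      det_prod_sub_eq_det_vandermonde (fun i => (m i : ℚ) ^ 2) (fun k => ((N : ℚ) + k + 1) ^ 2)]
    ring
  rw [sum_congr rfl fun m _ => hterm m, ← h]
  have hM := det_factorial_div_factorial x 1 (N + 1)
  have hfac : (Matrix.of fun i j : Fin x =>
      ((i : ℕ) ! : ℚ) * N.descFactorial (i + 1) * ((-1) ^ (j : ℕ) * (j : ℕ)! * (N + j)!) /
        (N ! * N !) * ((N + 1 + i + j)! / (1 + i + j)!)).det =
      (∏ i ∈ range x, (i ! : ℚ) * N.descFactorial (i + 1)) *
        ((∏ j ∈ range x, ((-1) ^ j * j ! * (N + j)! : ℚ) / (N ! * N !)) *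
          (Matrix.of fun i j : Fin x => ((N + 1 + i + j)! : ℚ) / (1 + i + j)!).det) := by
    have h1 := Matrix.det_mul_column
      (fun i : Fin x => ((i : ℕ) ! : ℚ) * N.descFactorial (i + 1))
      (Matrix.of fun i j : Fin x => ((-1) ^ (j : ℕ) * (j : ℕ)! * (N + j)! : ℚ) / (N ! * N !) *
        (((N + 1 + i + j)! : ℚ) / (1 + i + j)!))
    have h2 := Matrix.det_mul_row
      (fun j : Fin x => ((-1) ^ (j : ℕ) * (j : ℕ)! * (N + j)! : ℚ) / (N ! * N !))
      (Matrix.of fun i j : Fin x => ((N + 1 + i + j)! : ℚ) / (1 + i + j)!)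
    simp only [Matrix.of_apply] at h1 h2
    rw [prod_range, prod_range, ← h2, ← h1]
    congr 1
    ext i j
    simp only [Matrix.of_apply]
    ring
  rw [hfac, hM, ← prod_mul_distrib, ← prod_mul_distrib]
  refine prod_congr rfl fun k hk => ?_
  rw [mem_range] at hk
  have d1 : (N.descFactorial (k + 1) : ℚ) = N ! / (N - 1 - k)! := by
    rw [eq_div_iff (by positivity), ← Nat.factorial_mul_descFactorial (show k + 1 ≤ N by omega),
      show N - (k + 1) = N - 1 - k by omega]
    push_cast; ring
  have d2 : ∏ t ∈ range k, (((1 : ℕ) : ℚ) - (N + 1 : ℕ) + t) = (-1) ^ k * (N ! / (N - k)!) := by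
    have : (N ! / (N - k)! : ℚ) = ∏ t ∈ range k, ((N : ℚ) - t) := by
      rw [div_eq_iff (by positivity), ← Nat.factorial_mul_descFactorial (show k ≤ N by omega),
        Nat.descFactorial_eq_prod_range]
      push_cast
      rw [mul_comm]
      congr 1
      refine prod_congr rfl fun t ht => ?_
      rw [mem_range] at ht
      rw [Nat.cast_sub (by omega)]
    rw [this, ← card_range k, ← prod_const, card_range, ← prod_mul_distrib]
    refine prod_congr rfl fun t _ => ?_
    push_cast; ring
  rw [d1, d2, show 1 + x - 1 + k = x + k by omega]
  have hs : ((-1 : ℚ) ^ k) * (-1) ^ k = 1 := by rw [← mul_pow]; simp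
  field_simp
  linear_combination hs

/-- A weakly increasing filling of the triangle `{(i, j) | i ≤ j < n}`, extended by zero. -/
structure IsTriangle (n : ℕ) (t : ℕ → ℕ → ℕ) : Prop where
  eq_zero : ∀ i j, ¬ (i ≤ j ∧ j < n) → t i j = 0
  mono : ∀ i j i' j', i ≤ i' → j ≤ j' → i ≤ j → i' ≤ j' → j' < n → t i j ≤ t i' j'

/-- Gelfand–Tsetlin patterns, encoded as triangles with a prescribed diagonal. -/
abbrev Triangle (n : ℕ) (d : ℕ → ℕ) : Type :=
  {t : ℕ → ℕ → ℕ // IsTriangle n t ∧ ∀ i < n, t i i = d i}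

/-- Extension of a finite sequence by zero. -/
def extendZero {n : ℕ} (μ : Fin n → ℕ) (i : ℕ) : ℕ := if h : i < n then μ ⟨i, h⟩ else 0

/-- The diagonals interlacing with `d`. -/
def interlacing (n : ℕ) (d : ℕ → ℕ) : Finset (Fin n → ℕ) :=
  Fintype.piFinset fun i => Icc (d i) (d (i + 1))

theorem Triangle.sigma_ext {n : ℕ} {d : ℕ → ℕ}
    {p q : Σ μ : interlacing n d, Triangle n (extendZero μ.1)}
    (h₁ : p.1.1 = q.1.1) (h₂ : p.2.1 = q.2.1) : p = q := by
  obtain ⟨⟨μ, _⟩, t, _⟩ := p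
  obtain ⟨⟨ν, _⟩, s, _⟩ := q
  simp only at h₁ h₂
  subst h₁ h₂
  rfl

/-- Removing the diagonal of a triangle. -/
def Triangle.equivSigma (n : ℕ) (d : ℕ → ℕ)
    (hd : ∀ i j, i ≤ j → j < n + 1 → d i ≤ d j) :
    Triangle (n + 1) d ≃ Σ μ : interlacing n d, Triangle n (extendZero μ.1) where
  toFun t :=
    ⟨⟨fun i => t.1 i (i + 1), by
      obtain ⟨t, ht, hdiag⟩ := t
      simp only [interlacing, Fintype.mem_piFinset, mem_Icc]
      intro i
      rw [← hdiag i (by omega), ← hdiag (i + 1) (by omega)]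
      exact ⟨ht.mono _ _ _ _ le_rfl (by omega) le_rfl (by omega) (by omega),
        ht.mono _ _ _ _ (by omega) le_rfl (by omega) le_rfl (by omega)⟩⟩,
    ⟨fun i j => if i ≤ j then t.1 i (j + 1) else 0, by
      obtain ⟨t, ht, hdiag⟩ := t
      refine ⟨⟨?_, ?_⟩, ?_⟩
      · intro i j h
        split_ifs with hij
        · exact ht.eq_zero _ _ (by omega)
        · rfl
      · intro i j i' j' h1 h2 h3 h4 h5
        simp only [h3, h4, if_true]
        exact ht.mono _ _ _ _ (by omega) (by omega) (by omega) (by omega) (by omega)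
      · intro i hi
        simp [extendZero, hi]⟩⟩
  invFun p :=
    ⟨fun i j => if i = j ∧ i < n + 1 then d i else if i < j then p.2.1 i (j - 1) else 0, by
      obtain ⟨⟨μ, hμ⟩, t, ht, hdiag⟩ := p
      simp only [interlacing, Fintype.mem_piFinset, mem_Icc] at hμ
      have hμ' : ∀ i < n, d i ≤ t i i ∧ t i i ≤ d (i + 1) := by
        intro i hi
        rw [hdiag i hi]
        simpa [extendZero, hi] using hμ ⟨i, hi⟩
      refine ⟨⟨?_, ?_⟩, ?_⟩
      · intro i j h
        simp only
        rw [if_neg (by omega)]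
        split_ifs with hij
        · exact ht.eq_zero _ _ (by omega)
        · rfl
      · intro i j i' j' h1 h2 h3 h4 h5
        simp only
        rcases h3.eq_or_lt with rfl | h3 <;> rcases h4.eq_or_lt with rfl | h4
        · rw [if_pos (by omega), if_pos (by omega)]
          exact hd _ _ h1 (by omega)
        · rw [if_pos (by omega), if_neg (by omega), if_pos h4]
          exact (hμ' i (by omega)).1.trans
            (ht.mono _ _ _ _ (by omega) (by omega) (by omega) (by omega) (by omega))
        · rw [if_neg (by omega), if_pos h3, if_pos (by omega)]
          have h6 := (hμ' (i' - 1) (by omega)).2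
          rw [show i' - 1 + 1 = i' by omega] at h6
          exact (ht.mono _ _ _ _ (by omega) (by omega) (by omega) (by omega) (by omega)).trans h6
        · rw [if_neg (by omega), if_pos h3, if_neg (by omega), if_pos h4]
          exact ht.mono _ _ _ _ (by omega) (by omega) (by omega) (by omega) (by omega)
      · intro i hi
        simp [hi]⟩
  left_inv := by
    rintro ⟨t, ht, hdiag⟩
    ext i j
    simp only
    by_cases h : i = j ∧ i < n + 1
    · rw [if_pos h, ← h.1, hdiag i h.2]
    · rw [if_neg h]
      by_cases hij : i < j
      · rw [if_pos hij, if_pos (by omega), show j - 1 + 1 = j by omega]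
      · rw [if_neg hij, ht.eq_zero _ _ (by omega)]
  right_inv := by
    rintro ⟨⟨μ, hμ⟩, t, ht, hdiag⟩
    refine Triangle.sigma_ext ?_ ?_
    · ext i
      simp [hdiag i i.2, extendZero]
    · ext i j
      simp only
      by_cases hij : i ≤ j
      · rw [if_pos hij, if_neg (by omega), if_pos (by omega), Nat.add_sub_cancel]
      · rw [if_neg hij, ht.eq_zero _ _ (by omega)]

instance (d : ℕ → ℕ) : Unique (Triangle 0 d) where
  default := ⟨fun _ _ => 0, ⟨fun _ _ _ => rfl, fun _ _ _ _ _ _ _ _ _ => le_rfl⟩, by simp⟩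
  uniq t := by
    ext i j
    exact t.2.1.eq_zero _ _ (by omega)

theorem extendZero_mono {n : ℕ} {d : ℕ → ℕ} (hd : ∀ i j, i ≤ j → j < n + 1 → d i ≤ d j)
    {μ : Fin n → ℕ} (hμ : μ ∈ interlacing n d) (i j : ℕ) (hij : i ≤ j) (hj : j < n) :
    extendZero μ i ≤ extendZero μ j := by
  simp only [interlacing, Fintype.mem_piFinset, mem_Icc] at hμ
  rcases hij.eq_or_lt with rfl | hij
  · rfl
  · simp only [extendZero, hj, hij.trans hj, dif_pos]
    exact (hμ ⟨i, _⟩).2.trans ((hd _ _ hij (by omega)).trans (hμ ⟨j, hj⟩).1)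

theorem finite_triangle (n : ℕ) (d : ℕ → ℕ) (hd : ∀ i j, i ≤ j → j < n → d i ≤ d j) :
    Finite (Triangle n d) := by
  induction n generalizing d with
  | zero => infer_instance
  | succ n ih =>
    have : ∀ μ : interlacing n d, Finite (Triangle n (extendZero μ.1)) := fun μ =>
      ih _ (extendZero_mono hd μ.2)
    exact Finite.of_equiv _ (Triangle.equivSigma n d hd).symm

theorem sum_choose_Icc (a b i j : ℕ) (h : a ≤ b) :
    ∑ m ∈ Icc a b, ((m + i).choose j : ℚ) =
      (b + (i + 1)).choose (j + 1) - (a + i).choose (j + 1) := by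
  induction b, h using Nat.le_induction with
  | base =>
    rw [Icc_self, sum_singleton, ← add_assoc, Nat.choose_succ_succ']
    push_cast
    ring
  | succ b hb ih =>
    rw [sum_Icc_succ_top (by omega), ih, show b + 1 + (i + 1) = (b + 1 + i) + 1 by ring,
      Nat.choose_succ_succ', show b + 1 + i = b + (i + 1) by ring]
    push_cast
    ring

theorem card_triangle (n : ℕ) (d : ℕ → ℕ) (hd : ∀ i j, i ≤ j → j < n → d i ≤ d j) :
    (Nat.card (Triangle n d) : ℚ) =
      (Matrix.of fun i j : Fin n => ((d i + i).choose j : ℚ)).det := by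
  induction n generalizing d with
  | zero => simp
  | succ n ih =>
    have : ∀ μ : interlacing n d, Finite (Triangle n (extendZero μ.1)) := fun μ =>
      finite_triangle n _ (extendZero_mono hd μ.2)
    rw [Nat.card_congr (Triangle.equivSigma n d hd), Nat.card_sigma]
    push_cast
    rw [sum_congr rfl fun μ _ => ih _ (extendZero_mono hd μ.2),
      sum_coe_sort (interlacing n d) fun μ : Fin n → ℕ =>
        (Matrix.of fun i j : Fin n => ((extendZero μ i + i).choose j : ℚ)).det]
    have h := (Matrix.detRowAlternating (R := ℚ) (n := Fin n)).toMultilinearMap.map_sum_finset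
      (fun (i : Fin n) (m : ℕ) (j : Fin n) => ((m + i).choose j : ℚ))
      (fun i : Fin n => Icc (d i) (d (i + 1)))
    simp only [AlternatingMap.coe_multilinearMap] at h
    refine Eq.trans ?_ (h.symm.trans ?_)
    · refine sum_congr rfl fun μ _ => ?_
      simp only [extendZero, Fin.is_lt, dif_pos]
      rfl
    · let K : Matrix (Fin (n + 1)) (Fin (n + 1)) ℚ := Matrix.of fun i j =>
        Fin.cases ((d 0).choose j : ℚ) (fun i => ((d (i + 1) + (i + 1)).choose j : ℚ) -
          (d i + i).choose j) i
      have hK : (Matrix.of fun i j : Fin (n + 1) => ((d i + i).choose j : ℚ)).det = K.det := by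
        refine Matrix.det_eq_of_forall_row_eq_smul_add_pred (fun _ => 1) ?_ ?_
        · intro j; simp [K]
        · intro i j; simp [K]
      rw [hK, Matrix.det_succ_column_zero, Fin.sum_univ_succ]
      simp only [K, Matrix.of_apply, Fin.cases_zero, Fin.cases_succ, Fin.val_zero,
        Nat.choose_zero_right, Nat.cast_one, sub_self, mul_zero, zero_mul, sum_const_zero,
        add_zero, pow_zero, one_mul]
      refine congrArg Matrix.det ?_
      ext i j
      simp [sum_choose_Icc _ _ _ _ (hd i (i + 1) (by omega) (by omega))]

theorem card_triangle_mul_prod_factorial (n : ℕ) (d : ℕ → ℕ)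
    (hd : ∀ i j, i ≤ j → j < n → d i ≤ d j) :
    (Nat.card (Triangle n d) : ℚ) * ∏ k ∈ range n, (k ! : ℚ) =
      vandermondeProd n fun i => (d i + i : ℕ) := by
  rw [card_triangle n d hd, ← det_vandermonde_eq_vandermondeProd,
    ← det_prod_sub_eq_det_vandermonde _ (fun k => (k : ℚ)), prod_range, mul_comm,
    ← Matrix.det_mul_row]
  congr 1
  ext i j
  simp only [Matrix.of_apply]
  rw [← Nat.cast_mul, ← Nat.descFactorial_eq_factorial_mul_choose]
  generalize d i + i = a
  induction (j : ℕ) with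
  | zero => simp
  | succ j ih =>
    rw [prod_range_succ, ← ih, Nat.descFactorial_succ]
    rcases le_or_gt j a with h | h
    · push_cast [Nat.cast_sub h]; ring
    · rw [Nat.descFactorial_of_lt h]; simp

/-- The triangles of side `n` whose diagonal is self-complementary with respect to height `h`. -/
abbrev SelfComplTriangle (n h : ℕ) : Type :=
  {t : ℕ → ℕ → ℕ // IsTriangle n t ∧ ∀ i < n, t i i + t (n - 1 - i) (n - 1 - i) = h}

/-- The self-complementary filling of the `n × n` square extending a triangle. -/
def complFill (n h : ℕ) (t : ℕ → ℕ → ℕ) (i j : ℕ) : ℕ :=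
  if i ≤ j then t i j else h - t (n - 1 - i) (n - 1 - j)

namespace SelfComplTriangle

variable {n h : ℕ} (t : SelfComplTriangle n h)

theorem le_height {i j : ℕ} (hij : i ≤ j) (hj : j < n) : t.1 i j ≤ h :=
  (t.2.1.mono i j j j hij le_rfl hij le_rfl hj).trans ((Nat.le_add_right _ _).trans_eq
    (t.2.2 j hj))

theorem complFill_le (i j : ℕ) (hj : j < n) : complFill n h t.1 i j ≤ h := by
  unfold complFill
  split_ifs with hij
  · exact t.le_height hij hj
  · exact Nat.sub_le _ _

theorem complFill_add (i j : ℕ) (hi : i < n) (hj : j < n) :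
    complFill n h t.1 i j + complFill n h t.1 (n - 1 - i) (n - 1 - j) = h := by
  unfold complFill
  rcases lt_trichotomy i j with hij | rfl | hij
  · rw [if_pos hij.le, if_neg (by omega), show n - 1 - (n - 1 - i) = i by omega,
      show n - 1 - (n - 1 - j) = j by omega]
    have := t.le_height hij.le hj
    omega
  · simpa using t.2.2 i hi
  · rw [if_neg (by omega), if_pos (by omega)]
    have := t.le_height (i := n - 1 - i) (j := n - 1 - j) (by omega) (by omega)
    omega

theorem complFill_mono {i j i' j' : ℕ} (hi : i ≤ i') (hj : j ≤ j') (hi' : i' < n)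
    (hj' : j' < n) : complFill n h t.1 i j ≤ complFill n h t.1 i' j' := by
  obtain ⟨t, ht, hdiag⟩ := t
  unfold complFill
  split_ifs with h₁ h₂ h₂
  · exact ht.mono _ _ _ _ hi hj h₁ h₂ hj'
  · have h₃ := hdiag j' hj'
    have h₄ := ht.mono i j j' j' (by omega) (by omega) h₁ le_rfl hj'
    have h₅ := ht.mono (n - 1 - i') (n - 1 - j') (n - 1 - j') (n - 1 - j')
      (by omega) le_rfl (by omega) le_rfl (by omega)
    simp only
    omega
  · have h₃ := hdiag i (by omega)
    have h₄ := ht.mono i i i' j' hi (by omega) le_rfl h₂ hj'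
    have h₅ := ht.mono (n - 1 - i) (n - 1 - i) (n - 1 - i) (n - 1 - j)
      le_rfl (by omega) le_rfl (by omega) (by omega)
    simp only
    omega
  · have h₃ := ht.mono (n - 1 - i') (n - 1 - j') (n - 1 - i) (n - 1 - j)
      (by omega) (by omega) (by omega) (by omega) (by omega)
    simp only
    omega

end SelfComplTriangle

/-- The self-complementary plane partitions in the `n × n × h` box. -/
abbrev SelfComplPartition (n h : ℕ) : Type :=
  {S : Set (Fin n × Fin n × Fin h) //
    IsLowerSet S ∧ ∀ i j k, (i, j, k) ∈ S ↔ (i.rev, j.rev, k.rev) ∉ S}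

theorem Fin.mem_iff_lt_card_of_isLowerSet {h : ℕ} {A : Set (Fin h)} (hA : IsLowerSet A)
    (k : Fin h) : k ∈ A ↔ (k : ℕ) < Nat.card A := by
  classical
  rw [Nat.card_eq_fintype_card, ← Set.toFinset_card]
  constructor
  · intro hk
    have : Iic k ⊆ A.toFinset := fun l hl => by
      rw [Set.mem_toFinset]
      exact hA (mem_Iic.1 hl) hk
    simpa using card_le_card this
  · intro hk
    by_contra hkA
    have : A.toFinset ⊆ Iio k := fun l hl => by
      rw [Set.mem_toFinset] at hl
      rw [mem_Iio]
      by_contra hlk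
      exact hkA (hA (not_lt.1 hlk) hl)
    have := card_le_card this
    rw [Fin.card_Iio] at this
    omega

/-- The plane partition given by a self-complementary triangle. -/
def SelfComplTriangle.toPartition {n h : ℕ} (t : SelfComplTriangle n h) :
    SelfComplPartition n h :=
  ⟨{p | (p.2.2 : ℕ) < complFill n h t.1 (n - 1 - p.1) (n - 1 - p.2.1)}, by
    constructor
    · rintro ⟨i, j, k⟩ ⟨i', j', k'⟩ ⟨hi, hj, hk⟩ hm
      simp only [Set.mem_ofPred_eq, Fin.le_def] at *
      exact hk.trans_lt (hm.trans_le (t.complFill_mono (by omega) (by omega) (by omega)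
        (by omega)))
    · intro i j k
      have h₁ := t.complFill_add i j i.2 j.2
      simp only [Set.mem_ofPred_eq, Fin.val_rev, not_lt]
      rw [show n - 1 - (n - (i + 1)) = (i : ℕ) by omega,
        show n - 1 - (n - (j + 1)) = (j : ℕ) by omega]
      omega⟩

theorem SelfComplTriangle.toPartition_bijective (n h : ℕ) :
    Function.Bijective (toPartition (n := n) (h := h)) := by
  constructor
  · intro s t hst
    have key : ∀ i j (hi : i < n) (hj : j < n) (k : Fin h),
        (k : ℕ) < complFill n h s.1 i j ↔ (k : ℕ) < complFill n h t.1 i j := by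
      intro i j hi hj k
      have := Set.ext_iff.1 (congrArg Subtype.val hst)
        (⟨n - 1 - i, by omega⟩, ⟨n - 1 - j, by omega⟩, k)
      simpa [toPartition, show n - 1 - (n - 1 - i) = i by omega,
        show n - 1 - (n - 1 - j) = j by omega] using this
    ext i j
    by_cases hij : i ≤ j ∧ j < n
    · have hs := s.le_height hij.1 hij.2
      have ht := t.le_height hij.1 hij.2
      have := key i j (by omega) hij.2
      simp only [complFill, hij.1, if_true] at this
      by_contra hne
      rcases lt_or_gt_of_ne hne with hlt | hlt
      · have := this ⟨s.1 i j, by omega⟩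
        simp only at this
        omega
      · have := this ⟨t.1 i j, by omega⟩
        simp only at this
        omega
    · rw [s.2.1.eq_zero _ _ hij, t.2.1.eq_zero _ _ hij]
  · rintro ⟨S, hS, hcompl⟩
    let c : Fin n → Fin n → ℕ := fun i j => Nat.card {k : Fin h | (i.rev, j.rev, k) ∈ S}
    have hc : ∀ i j k, (i, j, k) ∈ S ↔ (k : ℕ) < c i.rev j.rev := by
      intro i j k
      have hlow : IsLowerSet {k : Fin h | (i.rev.rev, j.rev.rev, k) ∈ S} :=
        fun a b hab ha => hS (Prod.mk_le_mk.2 ⟨le_rfl, Prod.mk_le_mk.2 ⟨le_rfl, hab⟩⟩) ha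
      rw [← Fin.mem_iff_lt_card_of_isLowerSet hlow]
      simp
    have hch : ∀ i j, c i j ≤ h := by
      intro i j
      have := Nat.card_le_card_of_injective (Subtype.val :
        {k : Fin h | (i.rev, j.rev, k) ∈ S} → Fin h) Subtype.val_injective
      rwa [Nat.card_fin] at this
    have hcmono : ∀ i j i' j', i ≤ i' → j ≤ j' → c i j ≤ c i' j' := by
      intro i j i' j' hi hj
      refine Nat.card_mono (Set.toFinite _) fun k hk => ?_
      exact hS (Prod.mk_le_mk.2 ⟨Fin.rev_le_rev.2 hi,
        Prod.mk_le_mk.2 ⟨Fin.rev_le_rev.2 hj, le_rfl⟩⟩) hk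
    have hcadd : ∀ i j, c i j + c i.rev j.rev = h := by
      intro i j
      have key : ∀ k : Fin h, (k : ℕ) < c i.rev j.rev ↔ ¬ ((k.rev : ℕ) < c i j) := by
        intro k
        have := hcompl i j k
        rwa [hc, hc, Fin.rev_rev, Fin.rev_rev] at this
      have h₁ := hch i j
      have h₂ := hch i.rev j.rev
      by_contra hne
      rcases lt_or_gt_of_ne hne with hlt | hlt
      · have := key ⟨c i.rev j.rev, by omega⟩
        simp only [Fin.val_rev] at this
        omega
      · have := key ⟨c i.rev j.rev - 1, by omega⟩
        simp only [Fin.val_rev] at this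
        omega
    let t : ℕ → ℕ → ℕ := fun i j =>
      if hij : i ≤ j ∧ j < n then c ⟨i, by omega⟩ ⟨j, hij.2⟩ else 0
    have ht : IsTriangle n t := by
      refine ⟨fun i j hij => dif_neg hij, fun i j i' j' h₁ h₂ h₃ h₄ h₅ => ?_⟩
      simp only [t]
      rw [dif_pos ⟨h₃, by omega⟩, dif_pos ⟨h₄, h₅⟩]
      exact hcmono _ _ _ _ h₁ h₂
    have hdiag : ∀ i < n, t i i + t (n - 1 - i) (n - 1 - i) = h := by
      intro i hi
      simp only [t]
      rw [dif_pos ⟨le_rfl, hi⟩, dif_pos ⟨le_rfl, by omega⟩]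
      have := hcadd ⟨i, hi⟩ ⟨i, hi⟩
      have hrev : (⟨i, hi⟩ : Fin n).rev = ⟨n - 1 - i, by omega⟩ := by
        ext; simp only [Fin.val_rev]; omega
      rwa [hrev] at this
    have hfill : ∀ i j : Fin n, complFill n h t (n - 1 - i) (n - 1 - j) = c i.rev j.rev := by
      intro i j
      have h₁ : (⟨n - 1 - i, by omega⟩ : Fin n) = i.rev := by
        ext; simp only [Fin.val_rev]; omega
      have h₂ : (⟨n - 1 - j, by omega⟩ : Fin n) = j.rev := by
        ext; simp only [Fin.val_rev]; omega
      have h₃ := hcadd i j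
      simp only [complFill, t]
      by_cases hij : n - 1 - (i : ℕ) ≤ n - 1 - j
      · rw [if_pos hij, dif_pos ⟨hij, by omega⟩, h₁, h₂]
      · rw [if_neg hij, dif_pos ⟨by omega, by omega⟩]
        simp only [show n - 1 - (n - 1 - (i : ℕ)) = i by omega,
          show n - 1 - (n - 1 - (j : ℕ)) = j by omega, Fin.eta]
        omega
    refine ⟨⟨t, ht, hdiag⟩, Subtype.ext (Set.ext fun ⟨i, j, k⟩ => ?_)⟩
    simp only [toPartition, Set.mem_ofPred_eq, hfill, hc]

/-- The strictly increasing sequences of length `x` in `{1, …, N}`. -/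
def strictSeqs (N x : ℕ) : Finset (Fin x → ℕ) :=
  {m ∈ Fintype.piFinset (fun _ : Fin x => Icc 1 N) | StrictMono m}

/-- The self-complementary diagonal whose upper half is encoded by `m`. -/
def diagOfSeq (N : ℕ) {x : ℕ} (m : Fin x → ℕ) (i : ℕ) : ℕ := centered N x (extendZero m) i - i

theorem extendZero_mem_Icc {N x : ℕ} {m : Fin x → ℕ} (hm : m ∈ strictSeqs N x)
    {i : ℕ} (hi : i < x) :
    1 ≤ extendZero m i ∧ extendZero m i ≤ N := by
  simp only [strictSeqs, mem_filter, Fintype.mem_piFinset, mem_Icc] at hm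
  simpa [extendZero, hi] using hm.1 ⟨i, hi⟩

theorem extendZero_add_le {N x : ℕ} {m : Fin x → ℕ} (hm : m ∈ strictSeqs N x)
    {i j : ℕ} (hij : i ≤ j) (hj : j < x) :
    extendZero m i + (j - i) ≤ extendZero m j := by
  induction j, hij using Nat.le_induction with
  | base => simp
  | succ j hij ih =>
    have h := ih (by omega)
    have : extendZero m j < extendZero m (j + 1) := by
      simp only [strictSeqs, mem_filter] at hm
      simp only [extendZero, hj, show j < x by omega, dif_pos]
      exact hm.2 (Fin.mk_lt_mk.2 (by omega))
    omega

theorem centered_add_le {N x : ℕ} {m : Fin x → ℕ} (hm : m ∈ strictSeqs N x)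
    {i j : ℕ} (hij : i ≤ j) (hj : j < 2 * x) :
    centered N x (extendZero m) i + (j - i) ≤ centered N x (extendZero m) j := by
  unfold centered
  split_ifs with hi hj' hj'
  · have h₁ := extendZero_add_le hm (i := x - 1 - j) (j := x - 1 - i) (by omega) (by omega)
    have h₂ := extendZero_mem_Icc hm (i := x - 1 - i) (by omega)
    omega
  · have h₁ := extendZero_add_le hm (i := 0) (j := x - 1 - i) (by omega) (by omega)
    have h₂ := extendZero_mem_Icc hm (i := x - 1 - i) (by omega)
    have h₃ := extendZero_add_le hm (i := 0) (j := j - x) (by omega) (by omega)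
    have h₄ := extendZero_mem_Icc hm (i := 0) (by omega)
    omega
  · omega
  · have h₁ := extendZero_add_le hm (i := i - x) (j := j - x) (by omega) (by omega)
    omega

theorem diagOfSeq_add {N x : ℕ} {m : Fin x → ℕ} (hm : m ∈ strictSeqs N x)
    {i : ℕ} (hi : i < 2 * x) :
    diagOfSeq N m i + i = centered N x (extendZero m) i := by
  have := centered_add_le hm (Nat.zero_le i) hi
  unfold diagOfSeq
  omega

theorem diagOfSeq_mono {N x : ℕ} {m : Fin x → ℕ} (hm : m ∈ strictSeqs N x)
    (i j : ℕ) (hij : i ≤ j) (hj : j < 2 * x) :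
    diagOfSeq N m i ≤ diagOfSeq N m j := by
  have := centered_add_le hm hij hj
  have := diagOfSeq_add hm hj
  have := diagOfSeq_add hm (hij.trans_lt hj)
  omega

theorem card_triangle_diagOfSeq {N x : ℕ} {m : Fin x → ℕ} (hm : m ∈ strictSeqs N x) :
    (Nat.card (Triangle (2 * x) (diagOfSeq N m)) : ℚ) * ∏ k ∈ range (2 * x), (k ! : ℚ) =
      (∏ i, 2 * (m i : ℚ)) * (Matrix.vandermonde fun i => (m i : ℚ) ^ 2).det ^ 2 := by
  have h₁ : ∀ i : Fin x, extendZero m i = m i := fun i => by simp [extendZero]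
  have h₂ := vandermondeProd_centered N x fun i => (extendZero m i : ℚ)
  rw [prod_range, ← det_vandermonde_eq_vandermondeProd x] at h₂
  simp only [h₁] at h₂
  rw [card_triangle_mul_prod_factorial _ _ (diagOfSeq_mono hm), ← h₂]
  refine vandermondeProd_congr fun i hi => ?_
  rw [diagOfSeq_add hm hi]
  unfold centered
  split_ifs with hix
  · rw [Nat.cast_sub (extendZero_mem_Icc hm (by omega)).2]
  · push_cast
    rfl

/-- The sequence encoding the diagonal of a self-complementary triangle. -/
def SelfComplTriangle.seq {x y : ℕ} (t : SelfComplTriangle (2 * x) (2 * y + 1)) :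
    strictSeqs (x + y) x :=
  ⟨fun i => t.1 (x + i) (x + i) + (x + i) - (x + y), by
    have hbound : ∀ i < x, x + y + 1 ≤ t.1 (x + i) (x + i) + (x + i) := by
      intro i hi
      have h₁ := t.2.2 x (by omega)
      have h₂ := t.2.1.mono (2 * x - 1 - x) (2 * x - 1 - x) x x (by omega) (by omega) le_rfl
        le_rfl (by omega)
      have h₃ := t.2.1.mono x x (x + i) (x + i) (by omega) (by omega) le_rfl le_rfl (by omega)
      omega
    simp only [strictSeqs, mem_filter, Fintype.mem_piFinset, mem_Icc]
    refine ⟨fun i => ?_, fun i j hij => ?_⟩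
    · have h₁ := hbound i i.2
      have h₂ := t.le_height (le_refl (x + (i : ℕ))) (by omega)
      omega
    · have h₁ := hbound i i.2
      rw [Fin.lt_def] at hij
      have h₂ := t.2.1.mono (x + i) (x + i) (x + j) (x + j) (by omega) (by omega) le_rfl le_rfl
        (by omega)
      simp only
      omega⟩

/-- The triangles encoded by `m` are those with diagonal `diagOfSeq (x + y) m`. -/
def SelfComplTriangle.fiberEquiv {x y : ℕ} (m : strictSeqs (x + y) x) :
    {t : SelfComplTriangle (2 * x) (2 * y + 1) // t.seq = m} ≃
      Triangle (2 * x) (diagOfSeq (x + y) m.1) where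
  toFun t := ⟨t.1.1, t.1.2.1, by
    obtain ⟨⟨t, ht, hdiag⟩, rfl⟩ := t
    have hupper : ∀ i, x ≤ i → i < 2 * x → t i i =
        diagOfSeq (x + y) (seq ⟨t, ht, hdiag⟩).1 i := by
      intro i hi hi'
      have hadd := diagOfSeq_add (seq ⟨t, ht, hdiag⟩).2 hi'
      have hpos := extendZero_mem_Icc (seq ⟨t, ht, hdiag⟩).2 (i := i - x) (by omega)
      have hval : extendZero (seq ⟨t, ht, hdiag⟩).1 (i - x) = t i i + i - (x + y) := by
        simp [extendZero, show i - x < x by omega, seq, show x + (i - x) = i by omega]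
      simp only [centered, show ¬ i < x by omega, if_false] at hadd
      omega
    intro i hi
    by_cases hix : x ≤ i
    · exact hupper i hix hi
    · have h₁ := hupper (2 * x - 1 - i) (by omega) (by omega)
      have h₂ := hdiag i hi
      have h₃ := diagOfSeq_add (seq ⟨t, ht, hdiag⟩).2 hi
      have h₄ := diagOfSeq_add (seq ⟨t, ht, hdiag⟩).2 (i := 2 * x - 1 - i) (by omega)
      have h₅ := extendZero_mem_Icc (seq ⟨t, ht, hdiag⟩).2 (i := x - 1 - i) (by omega)
      simp only [centered, show i < x by omega, if_true] at h₃
      simp only [centered, show ¬ 2 * x - 1 - i < x by omega, if_false,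
        show 2 * x - 1 - i - x = x - 1 - i by omega] at h₄
      simp only
      omega⟩
  invFun t := ⟨⟨t.1, t.2.1, by
    intro i hi
    obtain ⟨t, ht, hdiag⟩ := t
    wlog hix : i < x generalizing i
    · have := this (2 * x - 1 - i) (by omega) (by omega)
      rw [show 2 * x - 1 - (2 * x - 1 - i) = i by omega] at this
      simp only at this ⊢
      omega
    have h₁ := hdiag i hi
    have h₂ := hdiag (2 * x - 1 - i) (by omega)
    have h₃ := diagOfSeq_add m.2 hi
    have h₄ := diagOfSeq_add m.2 (i := 2 * x - 1 - i) (by omega)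
    have h₅ := extendZero_mem_Icc m.2 (i := x - 1 - i) (by omega)
    simp only [centered, hix, if_true] at h₃
    simp only [centered, show ¬ 2 * x - 1 - i < x by omega, if_false,
      show 2 * x - 1 - i - x = x - 1 - i by omega] at h₄
    simp only
    omega⟩, by
    obtain ⟨t, ht, hdiag⟩ := t
    ext i
    have h₁ := hdiag (x + i) (by omega)
    have h₂ := diagOfSeq_add m.2 (i := x + i) (by omega)
    simp only [centered, show ¬ x + (i : ℕ) < x by omega, if_false, Nat.add_sub_cancel_left,
      extendZero, i.2, dif_pos, Fin.eta] at h₂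
    simp only [seq]
    omega⟩
  left_inv _ := rfl
  right_inv _ := rfl

theorem card_selfComplTriangle (x y : ℕ) :
    Nat.card (SelfComplTriangle (2 * x) (2 * y + 1)) =
      ∑ m ∈ strictSeqs (x + y) x, Nat.card (Triangle (2 * x) (diagOfSeq (x + y) m)) := by
  have e := (Equiv.sigmaFiberEquiv (SelfComplTriangle.seq (x := x) (y := y))).symm.trans
    (Equiv.sigmaCongrRight SelfComplTriangle.fiberEquiv)
  have : ∀ m : strictSeqs (x + y) x, Finite (Triangle (2 * x) (diagOfSeq (x + y) m.1)) :=
    fun m => finite_triangle _ _ (diagOfSeq_mono m.2)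
  rw [Nat.card_congr e, Nat.card_sigma, sum_coe_sort (strictSeqs (x + y) x) fun m =>
    Nat.card (Triangle (2 * x) (diagOfSeq (x + y) m))]

theorem SC_even_odd (x y : ℕ) (hx : 0 < x) (hy : 0 < y) :
    (Nat.card {S : Set (Fin (2 * x) × Fin (2 * x) × Fin (2 * y + 1)) //
        IsLowerSet S ∧
        (∀ i j k, (i, j, k) ∈ S ↔ (i.rev, j.rev, k.rev) ∉ S)} : ℚ) =
      PP x x y * PP x x (y + 1) := by
  have hpos : (∏ k ∈ range (2 * x), (k ! : ℚ)) ≠ 0 :=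
    prod_ne_zero_iff.2 fun k _ => by positivity
  rw [← Nat.card_congr (Equiv.ofBijective _
    (SelfComplTriangle.toPartition_bijective (2 * x) (2 * y + 1))), card_selfComplTriangle]
  refine mul_right_cancel₀ hpos ?_
  push_cast
  rw [sum_mul, sum_congr rfl fun m hm => card_triangle_diagOfSeq hm]
  refine (sum_strictMono_vandermonde_sq (x + y) x (by omega)).trans ?_
  rw [PP_eq_prod_factorial, PP_eq_prod_factorial, two_mul, prod_range_add,
    ← prod_mul_distrib, ← prod_mul_distrib, ← prod_mul_distrib]
  refine prod_congr rfl fun k _ => ?_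
  rw [show x + (y + 1) + k = x + y + 1 + k by ring, show x + (y + 1) - 1 - k = x + y - k by omega]
  field_simp
end

section
/- Let x and y be positive integers. The number of plane partitions S contained in the (2x+1)×(2x+1)×2y box that are self-complementary, i.e., (i,j,k) ∈ S if and only if (2x-i, 2x-j, 2y-1-k) ∉ S, equals PP(x,x+1,y)². -/
open Finset

/-- The Cauchy–Binet formula, summed over strictly monotone column selections. -/
theorem sum_strictMono_mul_det {R α : Type*} [CommRing R] [LinearOrder α] {n : ℕ} (s : Finset α)
    (p q : Fin n → α → R) :
    ∑ b ∈ (Fintype.piFinset fun _ : Fin n => s) with StrictMono b,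
      (Matrix.of fun i j => p i (b j)).det * (Matrix.of fun i j => q j (b i)).det =
    (Matrix.of fun i j => ∑ a ∈ s, p i a * q j a).det := by
  have h1 : (Matrix.of fun i j => ∑ a ∈ s, p i a * q j a).det =
      ∑ a ∈ Fintype.piFinset fun _ : Fin n => s,
        (∏ i, p i (a i)) * (Matrix.of fun i j => q j (a i)).det := by
    have : (Matrix.of fun i j => ∑ a ∈ s, p i a * q j a) =
        fun i => ∑ a ∈ s, (p i a • fun j => q j a) := by
      ext i j; simp [Finset.sum_apply]
    rw [this]
    have h := MultilinearMap.map_sum_finset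
      (Matrix.detRowAlternating (R := R) (n := Fin n)).toMultilinearMap
      (fun i a => p i a • fun j => q j a) (fun _ => s)
    refine h.trans (Finset.sum_congr rfl fun a _ => ?_)
    rw [MultilinearMap.map_smul_univ]
    rfl
  have h2 : ∑ a ∈ Fintype.piFinset fun _ : Fin n => s,
        (∏ i, p i (a i)) * (Matrix.of fun i j => q j (a i)).det =
      ∑ a ∈ (Fintype.piFinset fun _ : Fin n => s) with Function.Injective a,
        (∏ i, p i (a i)) * (Matrix.of fun i j => q j (a i)).det := by
    symm
    refine Finset.sum_filter_of_ne fun a _ hne => ?_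
    by_contra hinj
    simp only [Function.Injective, not_forall] at hinj
    obtain ⟨i, j, hij, hne'⟩ := hinj
    exact hne (by rw [Matrix.det_zero_of_row_eq hne' (by ext k; simp [hij]), mul_zero])
  have h3 : ∀ b : Fin n → α, (Matrix.of fun i j => p i (b j)).det *
        (Matrix.of fun i j => q j (b i)).det =
      ∑ σ : Equiv.Perm (Fin n), (∏ i, p i (b (σ i))) *
        (Matrix.of fun i j => q j (b (σ i))).det := by
    intro b
    rw [← Matrix.det_transpose (Matrix.of fun i j => p i (b j)), Matrix.det_apply, Finset.sum_mul]
    refine Finset.sum_congr rfl fun σ _ => ?_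
    have := Matrix.det_permute σ (Matrix.of fun i j => q j (b i))
    have e : (Matrix.of fun i j => q j (b (σ i))) =
      (Matrix.of fun i j => q j (b i)).submatrix σ id := rfl
    rw [e, this]
    simp [Units.smul_def]
    ring
  rw [h1, h2]
  simp_rw [h3]
  rw [← Finset.sum_product']
  refine Finset.sum_bij (fun x _ => x.1 ∘ x.2) ?_ ?_ ?_ ?_
  · rintro ⟨b, σ⟩ h
    simp only [mem_product, mem_filter, Fintype.mem_piFinset, mem_univ, and_true] at h ⊢
    exact ⟨fun i => h.1 _, h.2.injective.comp σ.injective⟩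
  · rintro ⟨b, σ⟩ h ⟨b', σ'⟩ h' e
    simp only [mem_product, mem_filter, Fintype.mem_piFinset, mem_univ, and_true] at h h' e
    have hb : b = b' := by
      rw [← h.2.range_inj h'.2, ← σ.surjective.range_comp b, e, σ'.surjective.range_comp]
    subst hb
    have : σ = σ' := by
      ext i
      exact congrArg _ (h.2.injective (congrFun e i))
    rw [this]
  · intro a h
    simp only [mem_filter, Fintype.mem_piFinset] at h
    refine ⟨(a ∘ Tuple.sort a, (Tuple.sort a)⁻¹), ?_, ?_⟩
    · simp only [mem_product, mem_filter, Fintype.mem_piFinset, mem_univ, and_true]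
      exact ⟨fun i => h.1 _, (Tuple.monotone_sort a).strictMono_of_injective
        (h.2.comp (Tuple.sort a).injective)⟩
    · ext i; simp
  · intros; rfl

theorem sum_cube_mul_prod_sq_sub_sq (i N : ℕ) :
    ∑ a ∈ Icc 1 N, 2 * (a : ℚ) ^ 3 * ∏ k ∈ range i, ((a : ℚ) ^ 2 - (k + 1) ^ 2) =
      (N : ℚ) ^ 2 * (N + 1) ^ 2 * (∏ k ∈ range i, ((N : ℚ) - (k + 1)) * (N + k + 2)) / (i + 2) := by
  have hi : (i : ℚ) + 2 ≠ 0 := by positivity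
  rw [eq_div_iff hi]
  induction N with
  | zero => simp
  | succ n ih =>
    rw [Finset.sum_Icc_succ_top (by omega), add_mul, ih]
    have h1 : ((n : ℚ) + 2) * ∏ k ∈ range i, (((n + 1 : ℕ) : ℚ) - (k + 1)) * ((n + 1 : ℕ) + k + 2) =
        (n + 2 + i) * ∏ k ∈ range i, (((n + 1 : ℕ) : ℚ) ^ 2 - (k + 1) ^ 2) := by
      clear ih hi
      induction i with
      | zero => simp
      | succ i ih =>
        rw [prod_range_succ, prod_range_succ, ← mul_assoc, ih]
        push_cast
        ring
    have h2 : (n : ℚ) * ∏ k ∈ range i, ((n : ℚ) - (k + 1)) * (n + k + 2) =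
        (n - i) * ∏ k ∈ range i, (((n + 1 : ℕ) : ℚ) ^ 2 - (k + 1) ^ 2) := by
      clear ih hi h1
      induction i with
      | zero => simp
      | succ i ih =>
        rw [prod_range_succ, prod_range_succ, ← mul_assoc, ih]
        push_cast
        ring
    set A := ∏ k ∈ range i, (((n + 1 : ℕ) : ℚ) - (k + 1)) * ((n + 1 : ℕ) + k + 2)
    set B := ∏ k ∈ range i, ((n : ℚ) - (k + 1)) * (n + k + 2)
    set P := ∏ k ∈ range i, (((n + 1 : ℕ) : ℚ) ^ 2 - (k + 1) ^ 2)
    push_cast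
    linear_combination (n : ℚ) * (n + 1) ^ 2 * h2 - (n + 1) ^ 2 * (n + 2) * h1

theorem choose_cast_mul_sub (n k : ℕ) :
    (n.choose (k + 1) : ℚ) * (k + 1) = n.choose k * (n - k) := by
  rcases le_or_gt k n with h | h
  · have := Nat.choose_succ_right_eq n k
    rw [← Nat.cast_sub h]
    exact_mod_cast this
  · simp [Nat.choose_eq_zero_of_lt h, Nat.choose_eq_zero_of_lt (h.trans (Nat.lt_succ_self k))]

/-- The moments of the weight `2 a ^ 3` on `{1, …, M + 1}` against two polynomial families in `a ^
2`. -/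
theorem sum_cube_mul_prod_mul_prod (M i j : ℕ) (hj : j ≤ M) :
    ∑ a ∈ Icc 1 (M + 1), 2 * (a : ℚ) ^ 3 * (∏ k ∈ range i, ((a : ℚ) ^ 2 - (k + 1) ^ 2)) *
        (∏ k ∈ range j, ((a : ℚ) ^ 2 - (M + 1 - k) ^ 2)) =
      ((M + i + 2).factorial * (i + 1).factorial : ℚ) *
        ((-1) ^ j * j.factorial / (M - j).factorial) * (M + 2).choose (i + j + 2) := by
  induction j generalizing i with
  | zero =>
    simp only [range_zero, prod_empty, mul_one]
    rw [sum_cube_mul_prod_sq_sub_sq]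
    have hi : (i : ℚ) + 2 ≠ 0 := by positivity
    have hM : (M.factorial : ℚ) ≠ 0 := by positivity
    have h1 : ((M : ℚ) + 2) * (M + 1) * ∏ k ∈ range i, ((M : ℚ) - k) =
        (i + 2) * (i + 1).factorial * (M + 2).choose (i + 2) := by
      induction i with
      | zero =>
        rw [Nat.cast_choose_two]
        push_cast; simp; ring
      | succ i ih =>
        have := choose_cast_mul_sub (M + 2) (i + 2)
        rw [prod_range_succ, ← mul_assoc, ih (by positivity),
          show i + 1 + 2 = i + 2 + 1 from rfl, Nat.factorial_succ (i + 1)]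
        push_cast at this ⊢
        linear_combination (-(i + 2) * (i + 1).factorial : ℚ) * this
    have h2 : (M.factorial : ℚ) * ((M + 1) * (M + 2) * ∏ k ∈ range i, ((M : ℚ) + k + 3)) =
        (M + i + 2).factorial := by
      clear h1 hi
      induction i with
      | zero => simp [Nat.factorial_succ]; ring
      | succ i ih =>
        rw [prod_range_succ, ← mul_assoc, ← mul_assoc, mul_assoc (M.factorial : ℚ), ih,
          show M + (i + 1) + 2 = (M + i + 2) + 1 by ring, Nat.factorial_succ (M + i + 2)]
        push_cast; ring
    rw [← h2, prod_mul_distrib]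
    push_cast
    simp only [add_sub_add_right_eq_sub, Nat.sub_zero, pow_zero, Nat.factorial_zero, Nat.cast_one,
      mul_one, add_zero]
    have e : ∀ k : ℕ, (M : ℚ) + 1 + k + 2 = M + k + 3 := fun k => by ring
    simp_rw [e]
    field_simp
    linear_combination ((M : ℚ) + 2) * h1
  | succ j ih =>
    have key : ∀ a : ℚ, 2 * a ^ 3 * (∏ k ∈ range i, (a ^ 2 - ((k : ℚ) + 1) ^ 2)) *
        (∏ k ∈ range (j + 1), (a ^ 2 - ((M : ℚ) + 1 - k) ^ 2)) =
        2 * a ^ 3 * (∏ k ∈ range (i + 1), (a ^ 2 - ((k : ℚ) + 1) ^ 2)) *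
        (∏ k ∈ range j, (a ^ 2 - ((M : ℚ) + 1 - k) ^ 2)) -
        (M - i - j) * (M + 2 + i - j) *
        (2 * a ^ 3 * (∏ k ∈ range i, (a ^ 2 - ((k : ℚ) + 1) ^ 2)) *
        (∏ k ∈ range j, (a ^ 2 - ((M : ℚ) + 1 - k) ^ 2))) := by
      intro a
      rw [prod_range_succ, prod_range_succ]
      ring
    simp_rw [key]
    rw [sum_sub_distrib, ← mul_sum, ih _ (by omega), ih _ (by omega)]
    have hc := choose_cast_mul_sub (M + 2) (i + j + 2)
    obtain ⟨d, rfl⟩ : ∃ d, M = j + 1 + d := ⟨M - (j + 1), by omega⟩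
    have e1 : j + 1 + d - j = d + 1 := by omega
    have e2 : j + 1 + d - (j + 1) = d := by omega
    have e3 : i + 1 + j + 2 = i + j + 2 + 1 := by ring
    have e4 : i + (j + 1) + 2 = i + j + 2 + 1 := by ring
    have e5 : j + 1 + d + (i + 1) + 2 = (j + 1 + d + i + 2) + 1 := by ring
    rw [e1, e2, e3, e4, e5, Nat.factorial_succ d, Nat.factorial_succ j,
      Nat.factorial_succ (j + 1 + d + i + 2), Nat.factorial_succ (i + 1), pow_succ]
    have hd : (d.factorial : ℚ) ≠ 0 := by positivity
    have hd' : (d : ℚ) + 1 ≠ 0 := by positivity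
    push_cast at hc ⊢
    field_simp
    linear_combination (d + i + 3 : ℚ) * hc

theorem sum_choose_mul_choose_add (n m i : ℕ) :
    ∑ k ∈ range (i + 1), i.choose k * n.choose (k + m) = (n + i).choose (i + m) := by
  induction i generalizing m with
  | zero => simp
  | succ i ih =>
    rw [show i + 1 + m = (i + m) + 1 by ring, ← add_assoc n, Nat.choose_succ_succ, ← ih m,
      Nat.succ_eq_add_one, add_assoc i m 1, ← ih (m + 1), sum_range_succ',
      sum_congr rfl fun k _ => by rw [Nat.choose_succ_succ, add_mul], sum_add_distrib,
      add_assoc]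
    have h := sum_range_succ' (fun k => i.choose k * n.choose (k + m)) (i + 1)
    rw [sum_range_succ, Nat.choose_succ_self] at h
    simp only [Nat.succ_eq_add_one, Nat.choose_zero_right, add_assoc, add_comm 1 m] at h ⊢
    omega

/-- The Hankel-type determinant of the binomial coefficients `(M + 2).choose (i + j + 2)`. -/
theorem abs_det_choose (M x : ℕ) (hx : x ≤ M + 1) :
    |(Matrix.of fun i j : Fin x => ((M + 2).choose (i + j + 2) : ℚ)).det| =
      ∏ i ∈ range x, ((M + 2 + i).factorial * i.factorial : ℚ) /
        ((M - i).factorial * (i + x + 1).factorial) := by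
  set L : Matrix (Fin x) (Fin x) ℚ := Matrix.of fun i k => ((i : ℕ).choose k : ℚ) with hL
  have hLdet : L.det = 1 := by
    rw [Matrix.det_of_isLowerTriangular]
    · simp [hL]
    · intro i j hij
      have : i < j := hij
      simp [hL, Nat.choose_eq_zero_of_lt this]
  have h1 : L * (Matrix.of fun i j : Fin x => ((M + 2).choose (i + j + 2) : ℚ)) =
      Matrix.of fun i j : Fin x => ((M + 2 + i).choose (i + j + 2) : ℚ) := by
    ext i j
    simp only [hL, Matrix.mul_apply, Matrix.of_apply]
    rw [show (i : ℕ) + j + 2 = i + (j + 2) by ring, ← sum_choose_mul_choose_add]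
    push_cast
    rw [Fin.sum_univ_eq_sum_range
      (fun k => ((i : ℕ).choose k : ℚ) * ((M + 2).choose (k + j + 2) : ℚ)) x]
    symm
    refine Finset.sum_subset (by simp) fun k _ hk => ?_
    simp only [mem_range, not_lt] at hk
    simp [Nat.choose_eq_zero_of_lt (show (i : ℕ) < k by omega)]
  have h2 : (Matrix.of fun i j : Fin x => ((M + 2 + i).choose (i + j + 2) : ℚ)) =
      Matrix.of fun i j : Fin x => (((M + 2 + i).factorial : ℚ) / (i + x + 1).factorial) *
        (Matrix.of fun i j : Fin x => (1 / ((M - j).factorial : ℚ)) *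
          (Matrix.of fun i j : Fin x =>
            ((descPochhammer ℚ (Fin.rev j)).eval ((i + x + 1 : ℕ) : ℚ))) i j) i j := by
    ext i j
    simp only [Matrix.of_apply]
    rw [descPochhammer_eval_eq_descFactorial, Nat.cast_choose ℚ (by omega)]
    have h := Nat.factorial_mul_descFactorial
      (show (Fin.rev j : ℕ) ≤ i + x + 1 by rw [Fin.val_rev]; omega)
    rw [show (i : ℕ) + x + 1 - (Fin.rev j : ℕ) = i + j + 2 by rw [Fin.val_rev]; omega] at h
    rw [show M + 2 + (i : ℕ) - (i + j + 2) = M - j by omega, ← h]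
    have : ((i + x + 1 : ℕ).descFactorial (Fin.rev j : ℕ) : ℚ) ≠ 0 := by
      intro h0
      have h0 : (i + x + 1 : ℕ).descFactorial (Fin.rev j : ℕ) = 0 := by exact_mod_cast h0
      rw [Nat.descFactorial_eq_zero_iff_lt, Fin.val_rev] at h0
      omega
    push_cast
    field_simp
  have h3 : |(Matrix.of fun i j : Fin x =>
      ((descPochhammer ℚ (Fin.rev j)).eval ((i + x + 1 : ℕ) : ℚ))).det| =
        ∏ i ∈ range x, (i.factorial : ℚ) := by
    have e : (Matrix.of fun i j : Fin x =>
      ((descPochhammer ℚ (Fin.rev j)).eval ((i + x + 1 : ℕ) : ℚ))) =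
      (Matrix.of fun i j : Fin x =>
      ((descPochhammer ℚ j).eval ((i + x + 1 : ℕ) : ℚ))).submatrix (Equiv.refl _) Fin.revPerm := by
      ext i j; simp
    rw [e, Matrix.abs_det_submatrix_equiv_equiv,
      ← Matrix.det_eval_matrixOfPolynomials_eq_det_vandermonde
        (fun i : Fin x => ((i + x + 1 : ℕ) : ℚ))
        (fun j => descPochhammer ℚ j) (fun j => descPochhammer_natDegree _ _)
        (fun j => monic_descPochhammer _ _)]
    have e2 : (fun i : Fin x => ((i + x + 1 : ℕ) : ℚ)) =
        fun i : Fin x => ((i : ℕ) : ℚ) + (x + 1) := by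
      ext i; push_cast; ring
    rw [e2, Matrix.det_vandermonde_add]
    cases x with
    | zero => simp
    | succ n =>
      rw [Matrix.det_vandermonde_id_eq_superFactorial, ← Nat.prod_range_factorial_succ]
      rw [prod_range_succ']
      simp only [Nat.factorial_zero, mul_one, Nat.cast_prod, Nat.cast_one]
      exact abs_of_nonneg (by positivity)
  have h4 := congrArg Matrix.det h1
  rw [Matrix.det_mul, hLdet, one_mul] at h4
  rw [h4, h2, Matrix.det_mul_column, Matrix.det_mul_row, abs_mul, abs_mul, h3, abs_prod, abs_prod,
    Fin.prod_univ_eq_prod_range (fun i => |((M + 2 + i).factorial : ℚ) / (i + x + 1).factorial|),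
    Fin.prod_univ_eq_prod_range (fun i => |1 / ((M - i).factorial : ℚ)|), ← prod_mul_distrib,
    ← prod_mul_distrib]
  refine prod_congr rfl fun i _ => ?_
  rw [abs_of_nonneg (by positivity), abs_of_nonneg (by positivity)]
  field_simp

/-- Triangular arrays `g i k`, `i + k < n`, with `g i k ≤ g i (k + 1) < g (i + 1) k` and first
column `l`, extended by zero. -/
def shiftedTriangles (n : ℕ) (l : Fin n → ℤ) : Set (ℕ → ℕ → ℤ) :=
  {g | (∀ i k, i + k + 1 < n → g i k ≤ g i (k + 1) ∧ g i (k + 1) < g (i + 1) k) ∧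
    (∀ i k, n ≤ i + k → g i k = 0) ∧ ∀ i : Fin n, g i 0 = l i}

/-- Removing the first column of a triangle. -/
def shiftedTrianglesSuccEquiv (n : ℕ) (l : Fin (n + 1) → ℤ) :
    shiftedTriangles (n + 1) l ≃
      Σ m : Fintype.piFinset fun i : Fin n => Ico (l i.castSucc) (l i.succ),
        shiftedTriangles n m.1 where
  toFun g := ⟨⟨fun i => g.1 i 1, by
      obtain ⟨g, h1, h2, h3⟩ := g
      rw [Fintype.mem_piFinset]
      intro i
      have := h1 i 0 (by omega)
      have e1 := h3 i.castSucc
      have e2 := h3 i.succ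
      simp only [Fin.val_castSucc, Fin.val_succ] at e1 e2
      rw [mem_Ico, ← e1, ← e2]
      exact this⟩,
    ⟨fun i k => g.1 i (k + 1), by
      obtain ⟨g, h1, h2, h3⟩ := g
      exact ⟨fun i k h => h1 i (k + 1) (by omega), fun i k h => h2 i (k + 1) (by omega),
        fun i => rfl⟩⟩⟩
  invFun p := ⟨fun i k => match k with
      | 0 => if h : i < n + 1 then l ⟨i, h⟩ else 0
      | k + 1 => p.2.1 i k, by
    obtain ⟨⟨m, hm⟩, ⟨g, h1, h2, h3⟩⟩ := p
    rw [Fintype.mem_piFinset] at hm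
    refine ⟨?_, ?_, ?_⟩
    · rintro i (_ | k) h
      · have e := hm ⟨i, by omega⟩
        have e' : g i 0 = m ⟨i, by omega⟩ := h3 ⟨i, by omega⟩
        rw [← e', mem_Ico] at e
        simpa [show i < n + 1 by omega, show i < n by omega] using e
      · exact h1 i k (by omega)
    · rintro i (_ | k) h
      · simp [show ¬ i < n + 1 by omega]
      · exact h2 i k (by omega)
    · intro i
      simp [i.isLt, -Order.lt_add_one_iff]⟩
  left_inv := by
    rintro ⟨g, h1, h2, h3⟩
    apply Subtype.ext
    funext i k
    cases k with
    | zero =>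
      by_cases h : i < n + 1
      · simpa [h] using (h3 ⟨i, h⟩).symm
      · simpa [h] using (h2 i 0 (by omega)).symm
    | succ k => rfl
  right_inv := by
    rintro ⟨⟨m, hm⟩, ⟨g, h1, h2, h3⟩⟩
    obtain rfl : (fun i : Fin n => g i 0) = m := funext h3
    rfl

theorem finite_shiftedTriangles (n : ℕ) (l : Fin n → ℤ) : Finite (shiftedTriangles n l) := by
  induction n with
  | zero =>
    have : Subsingleton (shiftedTriangles 0 l) := ⟨fun f g => Subtype.ext <| by
      funext i k
      rw [f.2.2.1 i k (by omega), g.2.2.1 i k (by omega)]⟩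
    infer_instance
  | succ n ih =>
    have := fun m => ih m
    exact Finite.of_equiv _ (shiftedTrianglesSuccEquiv n l).symm

theorem sum_Ico_descPochhammer_div_factorial (j : ℕ) {a b : ℤ} (h : a ≤ b) :
    ∑ m ∈ Ico a b, (descPochhammer ℚ j).eval (m : ℚ) / j.factorial =
      (descPochhammer ℚ (j + 1)).eval (b : ℚ) / (j + 1).factorial -
      (descPochhammer ℚ (j + 1)).eval (a : ℚ) / (j + 1).factorial := by
  induction b, h using Int.leInduction with
  | base => simp
  | succ b hb ih =>
    rw [← Finset.insert_Ico_right_eq_Ico_add_one hb, sum_insert (by simp), ih]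
    have h1 := descPochhammer_succ_eval (S := ℚ) j b
    have h2 : (descPochhammer ℚ (j + 1)).eval ((b : ℚ) + 1) =
        (b + 1) * (descPochhammer ℚ j).eval (b : ℚ) := by
      rw [descPochhammer_succ_left]; simp
    push_cast
    rw [h1, h2, Nat.factorial_succ]
    push_cast
    field_simp
    ring

theorem det_descPochhammer_succ (n : ℕ) (l : Fin (n + 1) → ℤ) :
    (Matrix.of fun i j : Fin (n + 1) =>
        (descPochhammer ℚ j).eval (l i : ℚ) / (j : ℕ).factorial).det =
      (Matrix.of fun i j : Fin n =>
        (descPochhammer ℚ (j + 1)).eval (l i.succ : ℚ) / ((j : ℕ) + 1).factorial -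
        (descPochhammer ℚ (j + 1)).eval (l i.castSucc : ℚ) / ((j : ℕ) + 1).factorial).det := by
  rw [Matrix.det_eq_of_forall_row_eq_smul_add_pred (B := Matrix.of fun i j : Fin (n + 1) =>
    (Fin.cons ((descPochhammer ℚ j).eval (l 0 : ℚ) / (j : ℕ).factorial) (fun i : Fin n =>
       (descPochhammer ℚ j).eval (l i.succ : ℚ) / (j : ℕ).factorial -
       (descPochhammer ℚ j).eval (l i.castSucc : ℚ) / (j : ℕ).factorial) : Fin (n + 1) → ℚ) i)
       (fun _ => 1), Matrix.det_succ_column_zero, Fin.sum_univ_succ]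
  · simp only [Fin.val_zero, pow_zero, one_mul, Matrix.of_apply, Fin.cons_zero, Fin.cons_succ]
    rw [Finset.sum_eq_zero (by simp)]
    simp
    rfl
  · simp
  · simp

theorem card_shiftedTriangles (n : ℕ) (l : Fin n → ℤ) (hl : StrictMono l) :
    (Nat.card (shiftedTriangles n l) : ℚ) =
      (Matrix.of fun i j : Fin n =>
        (descPochhammer ℚ j).eval (l i : ℚ) / (j : ℕ).factorial).det := by
  induction n with
  | zero =>
    have : Subsingleton (shiftedTriangles 0 l) := ⟨fun f g => Subtype.ext <| by
      funext i k
      rw [f.2.2.1 i k (by omega), g.2.2.1 i k (by omega)]⟩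
    have : Nonempty (shiftedTriangles 0 l) :=
      ⟨⟨fun _ _ => 0, by simp, by simp, fun i => i.elim0⟩⟩
    simp
  | succ n ih =>
    have := finite_shiftedTriangles n
    rw [Nat.card_congr (shiftedTrianglesSuccEquiv n l), Nat.card_sigma, det_descPochhammer_succ]
    have e : (Matrix.of fun i j : Fin n =>
        (descPochhammer ℚ (j + 1)).eval (l i.succ : ℚ) / ((j : ℕ) + 1).factorial -
        (descPochhammer ℚ (j + 1)).eval (l i.castSucc : ℚ) / ((j : ℕ) + 1).factorial) =
        fun i : Fin n => ∑ m ∈ Ico (l i.castSucc) (l i.succ),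
          fun j : Fin n => (descPochhammer ℚ j).eval (m : ℚ) / (j : ℕ).factorial := by
      ext i j
      simp only [Matrix.of_apply, Finset.sum_apply]
      rw [sum_Ico_descPochhammer_div_factorial _ (hl Fin.castSucc_lt_succ).le]
    rw [e]
    have h := MultilinearMap.map_sum_finset
      (Matrix.detRowAlternating (R := ℚ) (n := Fin n)).toMultilinearMap
      (fun _ m j => (descPochhammer ℚ j).eval ((m : ℤ) : ℚ) / (j : ℕ).factorial)
      (fun i => Ico (l i.castSucc) (l i.succ))
    refine Eq.trans ?_ h.symm
    rw [← Finset.sum_coe_sort (Fintype.piFinset fun i : Fin n => Ico (l i.castSucc) (l i.succ))]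
    push_cast
    refine Finset.sum_congr rfl fun m _ => ?_
    rw [ih]
    · rfl
    · have hm := m.2
      rw [Fintype.mem_piFinset] at hm
      cases n with
      | zero => exact fun i => i.elim0
      | succ n =>
        rw [Fin.strictMono_iff_lt_succ]
        intro i
        have h1 := (mem_Ico.1 (hm i.castSucc)).2
        have h2 := (mem_Ico.1 (hm i.succ)).1
        rw [Fin.succ_castSucc] at h1
        exact h1.trans_le h2

/-- Triangular arrays with prescribed diagonal `l` are counted by Weyl's dimension formula. -/
theorem card_shiftedTriangles_eq_prod (n : ℕ) (l : Fin n → ℤ) (hl : StrictMono l) :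
    (Nat.card (shiftedTriangles n l) : ℚ) =
      (∏ i : Fin n, ∏ j ∈ Ioi i, ((l j : ℚ) - l i)) / ∏ k ∈ range n, (k.factorial : ℚ) := by
  rw [card_shiftedTriangles n l hl, ← Matrix.det_vandermonde,
    Matrix.det_eval_matrixOfPolynomials_eq_det_vandermonde (fun i => (l i : ℚ))
      (fun j : Fin n => descPochhammer ℚ j) (fun j => descPochhammer_natDegree _ _)
        (fun j => monic_descPochhammer _ _), ← Fin.prod_univ_eq_prod_range
        (fun k => (k.factorial : ℚ)), div_eq_inv_mul, ← Finset.prod_inv_distrib,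
        ← Matrix.det_mul_row]
  congr 1
  ext i j
  simp [div_eq_inv_mul]

open Classical in
/-- The number of cells of `S` in the column over `(i, j)`, for `i, j < n`. -/
noncomputable def columnHeight {n m : ℕ} (S : Set (Fin n × Fin n × Fin m)) (i j : ℕ) : ℕ :=
  #{k : Fin m | ∃ p : Fin n × Fin n, (p.1 : ℕ) = i ∧ (p.2 : ℕ) = j ∧ (p.1, p.2, k) ∈ S}

theorem IsLowerSet.mem_iff_lt_columnHeight {n m : ℕ} {S : Set (Fin n × Fin n × Fin m)}
    (hS : IsLowerSet S) (i j : Fin n) (k : Fin m) :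
    (i, j, k) ∈ S ↔ (k : ℕ) < columnHeight S i j := by
  classical
  have e : columnHeight S i j = #{k : Fin m | (i, j, k) ∈ S} := by
    unfold columnHeight
    congr 1
    ext k
    simp only [mem_filter, mem_univ, true_and, Prod.exists]
    constructor
    · rintro ⟨a, b, h1, h2, h3⟩
      obtain rfl := Fin.ext h1
      obtain rfl := Fin.ext h2
      exact h3
    · exact fun h => ⟨i, j, rfl, rfl, h⟩
  rw [e]
  constructor
  · intro h
    have : Iic k ⊆ ({k : Fin m | (i, j, k) ∈ S} : Finset _) := fun k' hk' => by
      simp only [mem_filter, mem_univ, true_and]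
      exact hS (show (i, j, k') ≤ (i, j, k) from ⟨le_rfl, le_rfl, mem_Iic.1 hk'⟩) h
    have := card_le_card this
    rw [Fin.card_Iic] at this
    omega
  · intro h
    by_contra hk
    have : ({k : Fin m | (i, j, k) ∈ S} : Finset _) ⊆ Iio k := fun k' hk' => by
      simp only [mem_filter, mem_univ, true_and] at hk'
      rw [mem_Iio]
      by_contra hlt
      exact hk (hS (show (i, j, k) ≤ (i, j, k') from ⟨le_rfl, le_rfl, not_lt.1 hlt⟩) hk')
    have := card_le_card this
    rw [Fin.card_Iio] at this
    omega

theorem columnHeight_le {n m : ℕ} (S : Set (Fin n × Fin n × Fin m)) (i j : ℕ) :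
    columnHeight S i j ≤ m := by
  classical
  exact (card_le_univ _).trans_eq (Fintype.card_fin m)

theorem IsLowerSet.columnHeight_anti {n m : ℕ} {S : Set (Fin n × Fin n × Fin m)}
    (hS : IsLowerSet S) {i j i' j' : ℕ} (hi : i ≤ i') (hj : j ≤ j') (hi' : i' < n) (hj' : j' < n) :
    columnHeight S i' j' ≤ columnHeight S i j := by
  by_contra! h
  have hm := columnHeight_le S i' j'
  have h1 := hS.mem_iff_lt_columnHeight ⟨i', hi'⟩ ⟨j', hj'⟩ ⟨columnHeight S i j, by omega⟩
  have h2 := hS.mem_iff_lt_columnHeight ⟨i, by omega⟩ ⟨j, by omega⟩ ⟨columnHeight S i j, by omega⟩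
  simp only [h, lt_irrefl, iff_true, iff_false] at h1 h2
  exact h2 (hS
    (Prod.mk_le_mk.2 ⟨Fin.mk_le_mk.2 hi, Prod.mk_le_mk.2 ⟨Fin.mk_le_mk.2 hj, le_rfl⟩⟩) h1)

theorem columnHeight_eq {n m : ℕ} {S : Set (Fin n × Fin n × Fin m)}
    (hS : IsLowerSet S) (i j : Fin n) {h : ℕ} (hm : h ≤ m)
    (hh : ∀ k : Fin m, (i, j, k) ∈ S ↔ (k : ℕ) < h) : columnHeight S i j = h := by
  have h1 := fun k => (hS.mem_iff_lt_columnHeight i j k).symm.trans (hh k)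
  have h2 := columnHeight_le S i j
  rcases lt_trichotomy (columnHeight S i j) h with hlt | heq | hlt
  · have := h1 ⟨columnHeight S i j, by omega⟩
    simp only at this
    omega
  · exact heq
  · have := h1 ⟨h, by omega⟩
    simp only at this
    omega

theorem columnHeight_add_rev {x m : ℕ} {S : Set (Fin (2 * x + 1) × Fin (2 * x + 1) × Fin m)}
    (hS : IsLowerSet S) (hc : ∀ i j k, (i, j, k) ∈ S ↔ (i.rev, j.rev, k.rev) ∉ S)
    (i j : ℕ) (hi : i ≤ 2 * x) (hj : j ≤ 2 * x) :
    columnHeight S i j + columnHeight S (2 * x - i) (2 * x - j) = m := by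
  have h1 := columnHeight_le S (2 * x - i) (2 * x - j)
  rw [columnHeight_eq hS ⟨i, by omega⟩ ⟨j, by omega⟩
    (h := m - columnHeight S (2 * x - i) (2 * x - j)) (by omega), Nat.sub_add_cancel h1]
  intro k
  rw [hc, hS.mem_iff_lt_columnHeight]
  simp only [Fin.val_rev, Nat.add_sub_add_right]
  omega

/-- Triangles with antisymmetric diagonal. -/
def antisymmTriangles (x y : ℕ) : Set (ℕ → ℕ → ℤ) :=
  {g | (∀ i k, i + k + 1 < 2 * x + 1 → g i k ≤ g i (k + 1) ∧ g i (k + 1) < g (i + 1) k) ∧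
    (∀ i k, 2 * x + 1 ≤ i + k → g i k = 0) ∧ (∀ i ≤ 2 * x, g (2 * x - i) 0 = - g i 0) ∧
    g (2 * x) 0 ≤ x + y}

namespace antisymmTriangles

variable {x y : ℕ} {g : ℕ → ℕ → ℤ}

theorem diag_add_le (hg : g ∈ antisymmTriangles x y) {i j : ℕ} (hij : i ≤ j) (hj : j ≤ 2 * x) :
    g i 0 + (j - i) ≤ g j 0 := by
  induction j, hij using Nat.le_induction with
  | base => simp
  | succ j hij ih =>
    have h1 := ih (by omega)
    have h2 := hg.1 j 0 (by omega)
    push_cast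
    omega

theorem diag_le (hg : g ∈ antisymmTriangles x y) {i k : ℕ} (hj : i + k ≤ 2 * x) :
    g i 0 ≤ g i k := by
  induction k with
  | zero => simp
  | succ k ih => exact (ih (by omega)).trans (hg.1 i k (by omega)).1

theorem add_le_diag (hg : g ∈ antisymmTriangles x y) {i k : ℕ} (hj : i + k ≤ 2 * x) :
    g i k + k ≤ g (i + k) 0 := by
  induction k generalizing i with
  | zero => simp
  | succ k ih =>
    have h1 := ih (i := i + 1) (by omega)
    have h2 := (hg.1 i k (by omega)).2
    rw [show i + 1 + k = i + (k + 1) by ring] at h1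
    push_cast
    omega

theorem bounds (hg : g ∈ antisymmTriangles x y) {i k : ℕ} (hj : i + k ≤ 2 * x) :
    0 ≤ y + i - x - g i k ∧ y + i - x - g i k ≤ 2 * y := by
  have h1 := diag_le hg hj
  have h2 := add_le_diag hg hj
  have h3 := diag_add_le hg (Nat.zero_le i) (by omega)
  have h4 := diag_add_le hg hj le_rfl
  have h5 := hg.2.2.1 0 (by omega)
  have h6 := hg.2.2.2
  push_cast at *
  simp only [Nat.sub_zero] at h5
  omega

/-- The heights of the plane partition encoded by `g`. -/
def height (x y : ℕ) (g : ℕ → ℕ → ℤ) (i j : ℕ) : ℤ :=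
  if i ≤ j then y + i - x - g i (j - i) else y + i - x + g (2 * x - i) (i - j)

theorem height_rev (hg : g ∈ antisymmTriangles x y) {i j : ℕ} (hi : i ≤ 2 * x) (hj : j ≤ 2 * x) :
    height x y g (2 * x - i) (2 * x - j) = 2 * y - height x y g i j := by
  unfold height
  rcases lt_trichotomy i j with h | rfl | h
  · rw [if_neg (by omega), if_pos (by omega), show 2 * x - (2 * x - i) = i by omega,
      show 2 * x - i - (2 * x - j) = j - i by omega]
    push_cast [hi]
    ring
  · have := hg.2.2.1 i hi
    simp only [le_refl, if_true, Nat.sub_self, this]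
    push_cast [hi]
    ring
  · rw [if_pos (by omega), if_neg (by omega),
      show 2 * x - j - (2 * x - i) = i - j by omega]
    push_cast [hi]
    ring

theorem height_succ_right_le (hg : g ∈ antisymmTriangles x y) {i j : ℕ} (hi : i ≤ 2 * x)
    (hj : j + 1 ≤ 2 * x) : height x y g i (j + 1) ≤ height x y g i j := by
  unfold height
  rcases lt_trichotomy i (j + 1) with h | rfl | h
  · rw [if_pos (by omega), if_pos (by omega), show j + 1 - i = j - i + 1 by omega]
    have := (hg.1 i (j - i) (by omega)).1
    omega
  · rw [if_pos (by omega), if_neg (by omega), show j + 1 - j = 1 by omega, Nat.sub_self]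
    have := (hg.1 (2 * x - (j + 1)) 0 (by omega)).1
    have := hg.2.2.1 _ hi
    simp only [zero_add] at *
    omega
  · rw [if_neg (by omega), if_neg (by omega), show i - j = i - (j + 1) + 1 by omega]
    have := (hg.1 (2 * x - i) (i - (j + 1)) (by omega)).1
    omega

theorem height_succ_left_le (hg : g ∈ antisymmTriangles x y) {i j : ℕ} (hi : i + 1 ≤ 2 * x)
    (hj : j ≤ 2 * x) : height x y g (i + 1) j ≤ height x y g i j := by
  unfold height
  rcases lt_trichotomy i j with h | rfl | h
  · rw [if_pos (by omega), if_pos (by omega), show j - i = j - (i + 1) + 1 by omega]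
    have := (hg.1 i (j - (i + 1)) (by omega)).2
    push_cast
    omega
  · rw [if_neg (by omega), if_pos (by omega), show i + 1 - i = 1 by omega, Nat.sub_self]
    have := (hg.1 (2 * x - (i + 1)) 0 (by omega)).2
    have := hg.2.2.1 i (by omega)
    rw [show 2 * x - (i + 1) + 1 = 2 * x - i by omega] at *
    push_cast
    simp only [zero_add] at *
    omega
  · rw [if_neg (by omega), if_neg (by omega), show i + 1 - j = i - j + 1 by omega]
    have := (hg.1 (2 * x - (i + 1)) (i - j) (by omega)).2
    rw [show 2 * x - (i + 1) + 1 = 2 * x - i by omega] at *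
    push_cast
    omega

theorem height_anti (hg : g ∈ antisymmTriangles x y) {i j i' j' : ℕ} (hi : i ≤ i') (hj : j ≤ j')
    (hi' : i' ≤ 2 * x) (hj' : j' ≤ 2 * x) : height x y g i' j' ≤ height x y g i j := by
  have h1 : height x y g i' j' ≤ height x y g i j' := by
    induction i', hi using Nat.le_induction with
    | base => rfl
    | succ k _ ih => exact (height_succ_left_le hg hi' hj').trans (ih (by omega))
  have h2 : height x y g i j' ≤ height x y g i j := by
    clear h1
    induction j', hj using Nat.le_induction with
    | base => rfl
    | succ k _ ih =>
      exact (height_succ_right_le hg (by omega) hj').trans (ih (by omega))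
  exact h1.trans h2

theorem height_bounds (hg : g ∈ antisymmTriangles x y) {i j : ℕ} (hi : i ≤ 2 * x)
    (hj : j ≤ 2 * x) : 0 ≤ height x y g i j ∧ height x y g i j ≤ 2 * y := by
  have key : ∀ {i j : ℕ}, i ≤ j → j ≤ 2 * x →
      0 ≤ height x y g i j ∧ height x y g i j ≤ 2 * y := by
    intro i j h hj
    unfold height
    rw [if_pos h]
    exact bounds hg (by omega)
  rcases le_total i j with h | h
  · exact key h hj
  · have h1 := key (show 2 * x - i ≤ 2 * x - j by omega) (by omega)
    rw [height_rev hg hi hj] at h1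
    omega

theorem isLowerSet_setOf_lt_height (hg : g ∈ antisymmTriangles x y) :
    IsLowerSet {p : Fin (2 * x + 1) × Fin (2 * x + 1) × Fin (2 * y) |
      ((p.2.2 : ℕ) : ℤ) < height x y g p.1 p.2.1} := by
  rintro ⟨i', j', k'⟩ ⟨i, j, k⟩ ⟨h1, h2, h3⟩ h
  simp only [Set.mem_ofPred_eq, Fin.le_def] at *
  have := height_anti hg h1 h2 (by omega) (by omega)
  omega

end antisymmTriangles

/-- Self-complementary plane partitions as antisymmetric triangles. -/
noncomputable def selfComplementaryEquiv (x y : ℕ) :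
    {S : Set (Fin (2 * x + 1) × Fin (2 * x + 1) × Fin (2 * y)) //
        IsLowerSet S ∧ (∀ i j k, (i, j, k) ∈ S ↔ (i.rev, j.rev, k.rev) ∉ S)} ≃
      antisymmTriangles x y where
  toFun S := ⟨fun i k => if i + k < 2 * x + 1 then y + i - x - columnHeight S.1 i (i + k) else 0, by
    obtain ⟨S, hS, hc⟩ := S
    have hsymm := columnHeight_add_rev hS hc
    refine ⟨?_, ?_, ?_, ?_⟩
    · intro i k h
      have h1 := hS.columnHeight_anti (le_refl i) (show i + k ≤ i + (k + 1) by omega)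
        (by omega) (by omega)
      have h2 := hS.columnHeight_anti (show i ≤ i + 1 by omega) (le_refl (i + (k + 1)))
        (by omega) (by omega)
      beta_reduce
      rw [if_pos (by omega), if_pos (by omega), if_pos (by omega),
        show i + 1 + k = i + (k + 1) by ring]
      push_cast
      omega
    · intro i k h
      beta_reduce
      rw [if_neg (by omega)]
    · intro i hi
      have := hsymm i i hi hi
      beta_reduce
      rw [if_pos (by omega), if_pos (by omega), add_zero, add_zero]
      push_cast [hi]
      omega
    · beta_reduce
      rw [if_pos (by omega)]
      push_cast
      omega⟩
  invFun g := ⟨{p | ((p.2.2 : ℕ) : ℤ) < antisymmTriangles.height x y g.1 p.1 p.2.1},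
    antisymmTriangles.isLowerSet_setOf_lt_height g.2, fun i j k => by
      have := antisymmTriangles.height_rev g.2 (show (i : ℕ) ≤ 2 * x by omega)
        (show (j : ℕ) ≤ 2 * x by omega)
      simp only [Set.mem_ofPred_eq, Fin.val_rev, Nat.add_sub_add_right, this]
      omega⟩
  left_inv := by
    rintro ⟨S, hS, hc⟩
    have hsymm := columnHeight_add_rev hS hc
    apply Subtype.ext
    ext ⟨i, j, k⟩
    rw [hS.mem_iff_lt_columnHeight]
    simp only [Set.mem_ofPred_eq, antisymmTriangles.height]
    split_ifs with h1 h2 h3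
    · rw [show (i : ℕ) + (j - i) = j by omega]
      omega
    · omega
    · have := hsymm i j (by omega) (by omega)
      rw [show 2 * x - (i : ℕ) + (i - j) = 2 * x - j by omega]
      push_cast [show (i : ℕ) ≤ 2 * x by omega]
      omega
    · omega
  right_inv := by
    rintro ⟨g, hg⟩
    apply Subtype.ext
    funext i k
    simp only
    split_ifs with h
    · have hb := antisymmTriangles.height_bounds hg (i := i) (j := i + k) (by omega) (by omega)
      have := columnHeight_eq (antisymmTriangles.isLowerSet_setOf_lt_height hg) ⟨i, by omega⟩
        ⟨i + k, h⟩ (h := (antisymmTriangles.height x y g i (i + k)).toNat) (by omega) (fun k => by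
          simp only [Set.mem_ofPred_eq]; omega)
      simp only at this
      rw [this, Int.toNat_of_nonneg hb.1]
      simp [antisymmTriangles.height]
    · exact (hg.2.1 i k (by omega)).symm

/-- The sequence `-c (x - 1), …, -c 0, 0, c 0, …, c (x - 1), …`. -/
def oddReflection (x : ℕ) (c : ℕ → ℤ) (i : ℕ) : ℤ :=
  if i < x then -c (x - 1 - i) else if i = x then 0 else c (i - x - 1)

theorem oddReflection_succ (x : ℕ) (c : ℕ → ℤ) (i : ℕ) :
    oddReflection (x + 1) c (i + 1) = oddReflection x c i := by
  unfold oddReflection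
  simp only [Nat.add_lt_add_iff_right, Nat.add_right_cancel_iff, Nat.add_sub_add_right]
  rw [show x + 1 - 1 - (i + 1) = x - 1 - i by omega]

theorem prod_oddReflection {R : Type*} [CommMonoid R] (x : ℕ) (c : ℕ → ℤ) (f : ℤ → R) :
    ∏ i ∈ range (2 * x + 1), f (oddReflection x c i) =
      f 0 * ∏ s ∈ range x, f (c s) * f (-c s) := by
  induction x with
  | zero => simp [oddReflection]
  | succ x ih =>
    rw [show 2 * (x + 1) + 1 = (2 * x + 1) + 1 + 1 by ring, prod_range_succ, prod_range_succ']
    simp_rw [oddReflection_succ]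
    rw [ih, prod_range_succ, show oddReflection (x + 1) c 0 = -c x by simp [oddReflection],
      show oddReflection x c (2 * x + 1) = c x by
        rw [oddReflection, if_neg (by omega), if_neg (by omega)]; congr 1; omega]
    ac_rfl

/-- The Vandermonde product of an odd antisymmetric sequence. -/
theorem prod_sub_oddReflection (x : ℕ) (c : ℕ → ℤ) :
    ∏ j ∈ range (2 * x + 1), ∏ i ∈ range j, (oddReflection x c j - oddReflection x c i) =
      (∏ s ∈ range x, 2 * c s ^ 3) * (∏ t ∈ range x, ∏ s ∈ range t, (c t ^ 2 - c s ^ 2)) ^ 2 := by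
  induction x with
  | zero => simp
  | succ x ih =>
    have h0 : oddReflection (x + 1) c 0 = -c x := by simp [oddReflection]
    have h1 : oddReflection x c (2 * x + 1) = c x := by
      rw [oddReflection, if_neg (by omega), if_neg (by omega)]; congr 1; omega
    have hj : ∀ j, ∏ i ∈ range (j + 1),
        (oddReflection (x + 1) c (j + 1) - oddReflection (x + 1) c i) =
        (∏ i ∈ range j, (oddReflection x c j - oddReflection x c i)) *
          (oddReflection x c j - -c x) := fun j => by
      rw [prod_range_succ', h0, oddReflection_succ]
      simp_rw [oddReflection_succ]
    rw [show 2 * (x + 1) + 1 = (2 * x + 1) + 1 + 1 by ring, prod_range_succ, prod_range_succ', hj]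
    simp_rw [hj]
    rw [h1, range_zero, prod_empty, mul_one, prod_mul_distrib, ih,
      prod_oddReflection x c (fun z => z - -c x), prod_oddReflection x c (fun z => c x - z),
      prod_range_succ, prod_range_succ, mul_pow]
    have e : ∏ s ∈ range x, (c x ^ 2 - c s ^ 2) =
        ∏ s ∈ range x, ((c x - c s) * (c x - -c s)) := prod_congr rfl fun s _ => by ring
    have e' : ∏ s ∈ range x, (c x ^ 2 - c s ^ 2) =
        ∏ s ∈ range x, ((c s - -c x) * (-c s - -c x)) := prod_congr rfl fun s _ => by ring
    rw [← e, ← e']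
    ring

theorem Fin.prod_prod_Ioi_eq_prod_range {R : Type*} [CommMonoid R] (n : ℕ) (f : ℕ → ℕ → R) :
    ∏ i : Fin n, ∏ j ∈ Ioi i, f i j = ∏ j ∈ range n, ∏ i ∈ range j, f i j := by
  rw [← Fin.prod_univ_eq_prod_range (fun j => ∏ i ∈ range j, f i j),
    Finset.prod_comm' (t' := univ) (s' := fun j => Iio j) (by simp)]
  refine prod_congr rfl fun j _ => ?_
  rw [← Nat.Iio_eq_range, ← Fin.map_valEmbedding_Iio, prod_map]
  rfl

/-- MacMahon's product in terms of factorials. -/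
theorem PP_eq_prod_factorial_s19 (a b c : ℕ) :
    PP a b c = ∏ i ∈ range a, ((i + b + c).factorial * i.factorial : ℚ) /
      ((i + c).factorial * (i + b).factorial) := by
  have h1 : ∀ (r : ℚ), 0 ≤ r → ∏ k ∈ Icc 1 c, ((r + k + 1) / (r + k)) = (r + c + 1) / (r + 1) := by
    intro r hr
    induction c with
    | zero => simp; field_simp
    | succ c ih =>
      rw [prod_Icc_succ_top (by omega), ih]
      push_cast
      field_simp
      ring
  have h2 : ∀ i : ℕ, ∏ j ∈ Icc 1 b, (((i : ℚ) + j + c) / (i + j)) =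
      ((i + b + c).factorial * i.factorial : ℚ) / ((i + c).factorial * (i + b).factorial) := by
    intro i
    induction b with
    | zero => simp; field_simp
    | succ b ih =>
      rw [prod_Icc_succ_top (by omega), ih, show i + (b + 1) + c = (i + b + c) + 1 by ring,
        ← add_assoc i b 1, Nat.factorial_succ, Nat.factorial_succ]
      push_cast
      field_simp
      ring
  have h3 : ∀ f : ℕ → ℚ, ∏ i ∈ Icc 1 a, f i = ∏ i ∈ range a, f (i + 1) := by
    intro f
    rw [range_eq_Ico, Finset.prod_Ico_add' f 0 a 1]
    rfl
  unfold PP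
  rw [h3]
  refine prod_congr rfl fun i _ => ?_
  rw [← h2 i]
  refine prod_congr rfl fun j hj => ?_
  obtain ⟨j, rfl⟩ : ∃ t, j = t + 1 := ⟨j - 1, by have := (mem_Icc.1 hj).1; omega⟩
  have h := h1 (i + j) (by positivity)
  push_cast
  rw [show (i : ℚ) + (j + 1) + c = i + j + c + 1 by ring, ← add_assoc (i : ℚ) j 1, ← h]
  refine prod_congr rfl fun k _ => ?_
  congr 1 <;> ring

theorem oddReflection_reverse (x : ℕ) (c : ℕ → ℤ) {i : ℕ} (hi : i ≤ 2 * x) :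
    oddReflection x c (2 * x - i) = -oddReflection x c i := by
  unfold oddReflection
  rcases lt_trichotomy i x with h | rfl | h
  · rw [if_neg (by omega), if_neg (by omega), if_pos h, neg_neg]
    congr 1
    omega
  · simp [show 2 * i - i = i by omega]
  · rw [if_pos (by omega), if_neg (by omega), if_neg (by omega)]
    congr 2
    omega

theorem oddReflection_add (x : ℕ) (c : ℕ → ℤ) (s : ℕ) : oddReflection x c (x + 1 + s) = c s := by
  rw [oddReflection, if_neg (by omega), if_neg (by omega)]
  congr 1
  omega

theorem oddReflection_lt {x : ℕ} {c : ℕ → ℤ} (h0 : ∀ s < x, 0 < c s)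
    (hc : ∀ s t, s < t → t < x → c s < c t) {i j : ℕ} (hij : i < j) (hj : j ≤ 2 * x) :
    oddReflection x c i < oddReflection x c j := by
  unfold oddReflection
  split_ifs with h1 h2 h3 h4 h5 <;> try omega
  · exact neg_lt_neg (hc _ _ (by omega) (by omega))
  · exact neg_lt_zero.2 (h0 _ (by omega))
  · exact (neg_lt_zero.2 (h0 _ (by omega))).trans (h0 _ (by omega))
  · exact h0 _ (by omega)
  · exact hc _ _ (by omega) (by omega)

/-- The vector `-b (x - 1), …, -b 0, 0, b 0, …, b (x - 1)`. -/
def reflectionVector {x : ℕ} (b : Fin x → ℕ) (i : Fin (2 * x + 1)) : ℤ :=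
  oddReflection x (fun s => if h : s < x then (b ⟨s, h⟩ : ℤ) else 0) i

theorem strictMono_reflectionVector {x m : ℕ} {b : Fin x → ℕ}
    (hb : b ∈ (Fintype.piFinset fun _ : Fin x => Icc 1 m).filter StrictMono) :
    StrictMono (reflectionVector b) := by
  simp only [mem_filter, Fintype.mem_piFinset, mem_Icc] at hb
  intro i j hij
  refine oddReflection_lt (fun s hs => ?_) (fun s t hst ht => ?_) hij (by omega)
  · have := (hb.1 ⟨s, hs⟩).1
    simp only [hs, dif_pos]
    omega
  · have := hb.2 (show (⟨s, hst.trans ht⟩ : Fin x) < ⟨t, ht⟩ from hst)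
    simp only [ht, hst.trans ht, dif_pos]
    exact_mod_cast this

theorem mem_antisymmTriangles_of_mem_shiftedTriangles {x y : ℕ} {b : Fin x → ℕ}
    (hb : b ∈ (Fintype.piFinset fun _ : Fin x => Icc 1 (x + y)).filter StrictMono)
    {g : ℕ → ℕ → ℤ} (hg : g ∈ shiftedTriangles (2 * x + 1) (reflectionVector b)) :
    g ∈ antisymmTriangles x y := by
  simp only [mem_filter, Fintype.mem_piFinset, mem_Icc] at hb
  obtain ⟨h1, h2, h3⟩ := hg
  have h4 : ∀ i ≤ 2 * x, g i 0 = oddReflection x _ i := fun i hi => h3 ⟨i, by omega⟩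
  refine ⟨h1, h2, fun i hi => ?_, ?_⟩
  · rw [h4 i hi, h4 _ (by omega), oddReflection_reverse x _ hi]
  · rw [h4 _ le_rfl, oddReflection]
    split_ifs <;> try omega
    exact_mod_cast (hb.1 _).2

theorem exists_mem_shiftedTriangles {x y : ℕ} {g : ℕ → ℕ → ℤ} (hg : g ∈ antisymmTriangles x y) :
    ∃ b ∈ (Fintype.piFinset fun _ : Fin x => Icc 1 (x + y)).filter StrictMono,
      g ∈ shiftedTriangles (2 * x + 1) (reflectionVector b) := by
  have h0 : g x 0 = 0 := by
    have := hg.2.2.1 x (by omega)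
    rw [show 2 * x - x = x by omega] at this
    omega
  have hpos : ∀ s < x, 0 < g (x + 1 + s) 0 := fun s hs => by
    have := antisymmTriangles.diag_add_le hg (show x ≤ x + 1 + s by omega) (by omega)
    push_cast at this
    omega
  have hle : ∀ s < x, g (x + 1 + s) 0 ≤ x + y := fun s hs => by
    have := antisymmTriangles.diag_add_le hg (show x + 1 + s ≤ 2 * x by omega) le_rfl
    have := hg.2.2.2
    push_cast at *
    omega
  refine ⟨fun s => (g (x + 1 + s) 0).toNat, ?_, hg.1, hg.2.1, fun i => ?_⟩
  · simp only [mem_filter, Fintype.mem_piFinset, mem_Icc]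
    refine ⟨fun s => ?_, fun s t hst => ?_⟩
    · have := hpos s s.2
      have := hle s s.2
      omega
    · have hst' : (s : ℕ) < t := hst
      have := antisymmTriangles.diag_add_le hg (show x + 1 + s ≤ x + 1 + t by omega) (by omega)
      have := hpos s s.2
      have := hpos t t.2
      push_cast at *
      omega
  · have key : ∀ s < x, (if h : s < x then
        (((g (x + 1 + (⟨s, h⟩ : Fin x)) 0).toNat : ℕ) : ℤ) else 0) = g (x + 1 + s) 0 :=
      fun s hs => by rw [dif_pos hs, Int.toNat_of_nonneg (hpos s hs).le]
    have hi := i.2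
    simp only [reflectionVector, oddReflection]
    split_ifs with h1 h2 h3 h4 <;> try omega
    · have := hg.2.2.1 i (by omega)
      rw [Int.toNat_of_nonneg (hpos _ h2).le]
      rw [show x + 1 + (x - 1 - (i : ℕ)) = 2 * x - i by omega, this, neg_neg]
    · rw [h3, h0]
    · rw [Int.toNat_of_nonneg (hpos _ h4).le]
      congr 1
      omega

theorem eq_of_mem_shiftedTriangles {x : ℕ} {b b' : Fin x → ℕ} {g : ℕ → ℕ → ℤ}
    (h : g ∈ shiftedTriangles (2 * x + 1) (reflectionVector b))
    (h' : g ∈ shiftedTriangles (2 * x + 1) (reflectionVector b')) : b = b' := by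
  funext s
  have := (h.2.2 ⟨x + 1 + s, by omega⟩).symm.trans (h'.2.2 ⟨x + 1 + s, by omega⟩)
  simpa [reflectionVector, oddReflection_add] using this

/-- Antisymmetric triangles are sorted by the positive half of their diagonal. -/
theorem card_antisymmTriangles (x y : ℕ) : Nat.card (antisymmTriangles x y) =
    ∑ b ∈ (Fintype.piFinset fun _ : Fin x => Icc 1 (x + y)).filter StrictMono,
      Nat.card (shiftedTriangles (2 * x + 1) (reflectionVector b)) := by
  let B := (Fintype.piFinset fun _ : Fin x => Icc 1 (x + y)).filter StrictMono
  have := fun b : B => finite_shiftedTriangles (2 * x + 1) (reflectionVector b.1)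
  rw [← sum_coe_sort, ← Nat.card_sigma]
  refine (Nat.card_congr (Equiv.ofBijective (fun p => ⟨p.2.1,
    mem_antisymmTriangles_of_mem_shiftedTriangles p.1.2 p.2.2⟩) ⟨?_, ?_⟩)).symm
  · rintro ⟨⟨b, hb⟩, g, hg⟩ ⟨⟨b', hb'⟩, g', hg'⟩ h
    obtain rfl : g = g' := congrArg Subtype.val h
    obtain rfl := eq_of_mem_shiftedTriangles hg hg'
    rfl
  · rintro ⟨g, hg⟩
    obtain ⟨b, hb, h⟩ := exists_mem_shiftedTriangles hg
    exact ⟨⟨⟨b, hb⟩, g, h⟩, rfl⟩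

theorem card_shiftedTriangles_reflectionVector {x m : ℕ} {b : Fin x → ℕ}
    (hb : b ∈ (Fintype.piFinset fun _ : Fin x => Icc 1 m).filter StrictMono) :
    (Nat.card (shiftedTriangles (2 * x + 1) (reflectionVector b)) : ℚ) =
      ((∏ s, 2 * (b s : ℚ) ^ 3) * (∏ s, ∏ t ∈ Ioi s, ((b t : ℚ) ^ 2 - (b s : ℚ) ^ 2)) ^ 2) /
        ∏ k ∈ range (2 * x + 1), (k.factorial : ℚ) := by
  rw [card_shiftedTriangles_eq_prod _ _ (strictMono_reflectionVector hb)]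
  congr 1
  set c : ℕ → ℤ := fun s => if h : s < x then (b ⟨s, h⟩ : ℤ) else 0 with hc
  have e : ∀ s : Fin x, ((c s : ℤ) : ℚ) = b s := fun s => by simp [hc]
  have h := congrArg (Int.cast (R := ℚ)) (prod_sub_oddReflection x c)
  rw [← Fin.prod_prod_Ioi_eq_prod_range (2 * x + 1)
    (fun i j => oddReflection x c j - oddReflection x c i),
    ← Fin.prod_prod_Ioi_eq_prod_range x (fun s t => c t ^ 2 - c s ^ 2),
    ← Fin.prod_univ_eq_prod_range (fun s => 2 * c s ^ 3)] at h
  push_cast [e] at h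
  exact h

theorem det_prod_sub_eq_prod_prod_sub {R : Type*} [CommRing R] [Nontrivial R] [NoZeroDivisors R]
    {x : ℕ} (v : Fin x → R) (r : ℕ → R) :
    (Matrix.of fun i j : Fin x => ∏ k ∈ range j, (v i - r k)).det =
      ∏ i, ∏ j ∈ Ioi i, (v j - v i) := by
  have h := Matrix.det_eval_matrixOfPolynomials_eq_det_vandermonde v
    (fun j => ∏ k ∈ range j, (Polynomial.X - Polynomial.C (r k)))
    (fun j => by simp)
    (fun j => Polynomial.monic_prod_of_monic _ _ fun k _ => Polynomial.monic_X_sub_C _)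
  rw [← Matrix.det_vandermonde, h]
  congr 1
  ext i j
  simp [Polynomial.eval_prod]

theorem sum_prod_cube_mul_prod_prod_sub_sq (M x : ℕ) (hx : x ≤ M + 1) :
    ∑ b ∈ (Fintype.piFinset fun _ : Fin x => Icc 1 (M + 1)) with StrictMono b,
      (∏ s, 2 * (b s : ℚ) ^ 3) * (∏ s, ∏ t ∈ Ioi s, ((b t : ℚ) ^ 2 - (b s : ℚ) ^ 2)) ^ 2 =
    ∏ i ∈ range x, ((M + i + 2).factorial * (i + 1).factorial * (i.factorial / (M - i).factorial) *
      (((M + 2 + i).factorial * i.factorial) /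
        ((M - i).factorial * (i + x + 1).factorial)) : ℚ) := by
  have h := sum_strictMono_mul_det (Icc 1 (M + 1))
    (fun (i : Fin x) (a : ℕ) => 2 * (a : ℚ) ^ 3 * ∏ k ∈ range i, ((a : ℚ) ^ 2 - (k + 1) ^ 2))
    (fun (j : Fin x) (a : ℕ) => ∏ k ∈ range j, ((a : ℚ) ^ 2 - (M + 1 - k) ^ 2))
  have hl : ∀ b : Fin x → ℕ,
      (Matrix.of fun i j : Fin x => 2 * (b j : ℚ) ^ 3 *
        ∏ k ∈ range i, ((b j : ℚ) ^ 2 - (k + 1) ^ 2)).det *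
      (Matrix.of fun i j : Fin x => ∏ k ∈ range j, ((b i : ℚ) ^ 2 - (M + 1 - k) ^ 2)).det =
      (∏ s, 2 * (b s : ℚ) ^ 3) * (∏ s, ∏ t ∈ Ioi s, ((b t : ℚ) ^ 2 - (b s : ℚ) ^ 2)) ^ 2 := by
    intro b
    have h1 := Matrix.det_mul_row (fun s => 2 * (b s : ℚ) ^ 3)
      (Matrix.of fun i j : Fin x => ∏ k ∈ range i, ((b j : ℚ) ^ 2 - (k + 1) ^ 2))
    simp only [Matrix.of_apply] at h1
    rw [h1, ← Matrix.det_transpose (Matrix.of fun i j : Fin x => ∏ k ∈ range i, _),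
      det_prod_sub_eq_prod_prod_sub (fun i => (b i : ℚ) ^ 2) (fun k => ((M : ℚ) + 1 - k) ^ 2)]
    have h2 := det_prod_sub_eq_prod_prod_sub (fun i => (b i : ℚ) ^ 2) (fun k => ((k : ℚ) + 1) ^ 2)
    have h3 : (Matrix.of fun i j : Fin x => ∏ k ∈ range i, ((b j : ℚ) ^ 2 - (k + 1) ^ 2)).transpose
      = Matrix.of fun i j : Fin x => ∏ k ∈ range j, ((b i : ℚ) ^ 2 - (k + 1) ^ 2) := rfl
    rw [h3, h2]
    ring
  simp only [hl] at h
  have hr : (Matrix.of fun i j : Fin x => ∑ a ∈ Icc 1 (M + 1),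
      2 * (a : ℚ) ^ 3 * (∏ k ∈ range i, ((a : ℚ) ^ 2 - (k + 1) ^ 2)) *
        ∏ k ∈ range j, ((a : ℚ) ^ 2 - (M + 1 - k) ^ 2)) =
      Matrix.of fun i j : Fin x => (((M + i + 2).factorial * ((i : ℕ) + 1).factorial : ℕ) : ℚ) *
        (Matrix.of fun i j : Fin x => ((-1) ^ (j : ℕ) * (j : ℕ).factorial / (M - j).factorial : ℚ) *
        (Matrix.of fun i j : Fin x => ((M + 2).choose (i + j + 2) : ℚ)) i j) i j := by
    ext i j
    simp only [Matrix.of_apply]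
    rw [sum_cube_mul_prod_mul_prod M i j (by omega)]
    push_cast
    ring
  rw [hr, Matrix.det_mul_column, Matrix.det_mul_row] at h
  refine (abs_of_nonneg (sum_nonneg fun b _ => by positivity)).symm.trans ?_
  rw [h, abs_mul, abs_mul, abs_det_choose M x hx, abs_prod, abs_prod,
    Fin.prod_univ_eq_prod_range
      (fun i => |(((M + i + 2).factorial * (i + 1).factorial : ℕ) : ℚ)|) x,
    Fin.prod_univ_eq_prod_range (fun j => |((-1) ^ j * j.factorial / (M - j).factorial : ℚ)|) x,
    ← prod_mul_distrib, ← prod_mul_distrib]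
  refine prod_congr rfl fun i _ => ?_
  rw [Nat.abs_cast, abs_div, abs_mul, abs_pow, abs_neg, abs_one, one_pow, Nat.abs_cast,
    Nat.abs_cast]
  push_cast
  ring

theorem prod_factorial_two_mul_add_one (x : ℕ) : ∏ k ∈ range (2 * x + 1), (k.factorial : ℚ) =
    ∏ i ∈ range x, ((i + 1).factorial * (i + x + 1).factorial : ℚ) := by
  rw [prod_range_succ', two_mul, prod_range_add, prod_mul_distrib]
  simp [add_comm]

theorem SC_odd_even (x y : ℕ) (hx : 0 < x) (hy : 0 < y) :
    (Nat.card {S : Set (Fin (2 * x + 1) × Fin (2 * x + 1) × Fin (2 * y)) //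
        IsLowerSet S ∧
        (∀ i j k, (i, j, k) ∈ S ↔ (i.rev, j.rev, k.rev) ∉ S)} : ℚ) =
      PP x (x + 1) y ^ 2 := by
  obtain ⟨M, hM⟩ : ∃ M, x + y = M + 1 := ⟨x + y - 1, by omega⟩
  rw [Nat.card_congr (selfComplementaryEquiv x y), card_antisymmTriangles, Nat.cast_sum,
    sum_congr rfl fun b hb => card_shiftedTriangles_reflectionVector hb, ← sum_div, hM,
    sum_prod_cube_mul_prod_prod_sub_sq M x (by omega), prod_factorial_two_mul_add_one,
    PP_eq_prod_factorial_s19, ← prod_div_distrib, ← prod_pow]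
  have hrefl : ∏ i ∈ range x, ((M - i).factorial : ℚ) = ∏ i ∈ range x, ((i + y).factorial : ℚ) := by
    rw [← prod_range_reflect]
    refine prod_congr rfl fun i hi => ?_
    have := mem_range.1 hi
    rw [show M - (x - 1 - i) = i + y by omega]
  have hne : ∀ f : ℕ → ℕ, ∏ i ∈ range x, ((f i).factorial : ℚ) ≠ 0 := fun f =>
    prod_ne_zero_iff.2 fun i _ => by positivity
  have e : ∀ i, i + x + 1 + y = M + 2 + i := fun i => by omega
  simp only [← add_assoc, e, show ∀ i, M + i + 2 = M + 2 + i from fun i => by ring]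
  simp only [prod_div_distrib, prod_mul_distrib, prod_pow, hrefl]
  have := hne fun i => i + 1
  have := hne fun i => i + y
  have := hne fun i => i + x + 1
  field_simp
end
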